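/- arXiv:1605.04150 — 4 statements merged into one kernel-verified Lean document; each statement's English description precedes it below -/
import Mathlib

section
/- Let n ≥ 1, p ≥ 1, let u₀ : ℝⁿ → ℝ be continuous and everywhere positive, and let u be any global positive classical solution of the Cauchy problem (P) with initial data u₀. Then for every R > 0, inf_{|x|<R} { t^{1/p} u(x,t) } → +∞ as t → ∞; that is, for every R > 0 and every M > 0 there exists T > 0 such that t^{1/p} u(x,t) ≥ M for all t ≥ T and all x with |x| < R. -/
open MeasureTheory
open scoped ENNReal
noncomputable section

abbrev Euc (n : ℕ) := EuclideanSpace ℝ (Fin n)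

/-- The Laplacian (in the spatial variables) of `f : ℝⁿ → ℝ`, as the sum of the
second partial derivatives. -/
def lap (n : ℕ) (f : Euc n → ℝ) (x : Euc n) : ℝ :=
  ∑ i : Fin n, iteratedFDeriv ℝ 2 f x ![EuclideanSpace.single i 1, EuclideanSpace.single i 1]

/-- `IsSolP n p u₀ u T` means: `u` is a classical solution of the Cauchy problem (P):
`∂ₜ u = uᵖ Δu` on `ℝⁿ × (0,T)`, `u(·,0) = u₀`, belonging to
`C⁰(ℝⁿ × [0,T)) ∩ C^{2,1}(ℝⁿ × (0,T))`.  Here `T ∈ (0,∞]` is encoded as `T : ℝ≥0∞`. -/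
structure IsSolP (n : ℕ) (p : ℝ) (u₀ : Euc n → ℝ) (u : Euc n → ℝ → ℝ) (T : ℝ≥0∞) : Prop where
  cont : ContinuousOn (fun q : Euc n × ℝ => u q.1 q.2) {q | 0 ≤ q.2 ∧ ENNReal.ofReal q.2 < T}
  init : ∀ x, u x 0 = u₀ x
  reg_space : ∀ t : ℝ, 0 < t → ENNReal.ofReal t < T → ContDiff ℝ 2 fun x => u x t
  reg_time : ∀ x, ∀ t : ℝ, 0 < t → ENNReal.ofReal t < T → DifferentiableAt ℝ (u x) t
  pde : ∀ x, ∀ t : ℝ, 0 < t → ENNReal.ofReal t < T →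
    deriv (u x) t = u x t ^ p * lap n (fun y => u y t) x

/-- `u` is positive on `ℝⁿ × [0,T)`. -/
def PosOn (n : ℕ) (u : Euc n → ℝ → ℝ) (T : ℝ≥0∞) : Prop :=
  ∀ x : Euc n, ∀ t : ℝ, 0 ≤ t → ENNReal.ofReal t < T → 0 < u x t

/-- `u` is the minimal global positive classical solution of (P) with initial data `u₀`:
it is a global positive classical solution and lies below every positive classical solution
with the same initial data on its interval of existence `[0,T)`, `T ∈ (0,∞]`. -/
def IsMinSolP (n : ℕ) (p : ℝ) (u₀ : Euc n → ℝ) (u : Euc n → ℝ → ℝ) : Prop :=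
  IsSolP n p u₀ u ⊤ ∧ PosOn n u ⊤ ∧
    ∀ T : ℝ≥0∞, 0 < T → ∀ v : Euc n → ℝ → ℝ, IsSolP n p u₀ v T → PosOn n v T →
      ∀ x : Euc n, ∀ t : ℝ, 0 ≤ t → ENNReal.ofReal t < T → u x t ≤ v x t

theorem deriv_deriv_nonneg_of_isLocalMin {g : ℝ → ℝ} {a : ℝ} (h : IsLocalMin g a)
    (hc : ContinuousAt g a) : 0 ≤ deriv (deriv g) a := by
  by_contra! hneg
  have hmax : IsLocalMax g a := isLocalMax_of_deriv_deriv_neg hneg h.deriv_eq_zero hc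
  have hconst : g =ᶠ[nhds a] fun _ => g a := by
    filter_upwards [h, hmax] with y h1 h2 using le_antisymm h2 h1
  have h0 : deriv (deriv g) a = 0 := by
    rw [hconst.deriv.deriv_eq]
    simp
  exact hneg.ne h0

theorem deriv_nonpos_of_forall_lt_ge {g : ℝ → ℝ} {a b : ℝ} (hab : a < b)
    (hd : DifferentiableAt ℝ g b) (h : ∀ t, a ≤ t → t < b → g b ≤ g t) : deriv g b ≤ 0 := by
  have hs := (hasDerivWithinAt_iff_tendsto_slope' (Set.self_notMem_Iio (a := b))).1
    hd.hasDerivAt.hasDerivWithinAt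
  refine le_of_tendsto hs ?_
  filter_upwards [Ico_mem_nhdsLT hab] with t ht
  rw [slope_def_field]
  exact div_nonpos_of_nonneg_of_nonpos (sub_nonneg.2 (h t ht.1 ht.2)) (sub_nonpos.2 ht.2.le)

/-- Along a coordinate line, the second derivative of a `C²` function plus a multiple of the
squared norm. -/
theorem deriv_deriv_add_sq_line {n : ℕ} {f : Euc n → ℝ} (hf : ContDiff ℝ 2 f) (k : ℝ) (x e : Euc n) :
    deriv (deriv fun s : ℝ => f (x + s • e) + k * ‖x + s • e‖ ^ 2) 0
      = iteratedFDeriv ℝ 2 f x ![e, e] + 2 * k * ‖e‖ ^ 2 := by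
  have hline : ∀ s : ℝ, HasDerivAt (fun s : ℝ => x + s • e) e s := fun s => by
    simpa using ((hasDerivAt_id s).smul_const e).const_add x
  have h1 : ∀ s : ℝ, HasDerivAt (fun s : ℝ => f (x + s • e) + k * ‖x + s • e‖ ^ 2)
      (fderiv ℝ f (x + s • e) e + k * (2 * inner ℝ (x + s • e) e)) s := fun s => by
    have hd : HasFDerivAt f (fderiv ℝ f (x + s • e)) (x + s • e) :=
      (hf.differentiable (by norm_num) _).hasFDerivAt
    exact (hd.comp_hasDerivAt s (hline s)).add ((hline s).norm_sq.const_mul k)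
  rw [funext fun s => (h1 s).deriv]
  have hf' : ContDiff ℝ 1 (fderiv ℝ f) := hf.fderiv_right (by norm_num)
  have h2 : HasDerivAt (fun s : ℝ => fderiv ℝ f (x + s • e) e)
      (fderiv ℝ (fderiv ℝ f) x e e) 0 := by
    have hx : x + (0 : ℝ) • e = x := by simp
    have hd : HasFDerivAt (fderiv ℝ f) (fderiv ℝ (fderiv ℝ f) x) (x + (0 : ℝ) • e) := by
      rw [hx]
      exact (hf'.differentiable one_ne_zero x).hasFDerivAt
    exact ((ContinuousLinearMap.apply ℝ ℝ e).hasFDerivAt.comp _ hd).comp_hasDerivAt 0 (hline 0)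
  have h3 : HasDerivAt (fun s : ℝ => k * (2 * inner ℝ (x + s • e) e)) (k * (2 * ‖e‖ ^ 2)) 0 := by
    have h := (((hline 0).inner ℝ (hasDerivAt_const (0 : ℝ) e)).const_mul 2).const_mul k
    simpa using h
  rw [(h2.fun_add h3).deriv, iteratedFDeriv_two_apply]
  simp
  ring

theorem neg_two_mul_le_lap_of_isLocalMin {n : ℕ} {f : Euc n → ℝ} (hf : ContDiff ℝ 2 f) {k : ℝ}
    {x : Euc n} (h : IsLocalMin (fun y => f y + k * ‖y‖ ^ 2) x) : -(2 * n * k) ≤ lap n f x := by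
  have key : ∀ i : Fin n, -(2 * k) ≤
      iteratedFDeriv ℝ 2 f x ![EuclideanSpace.single i 1, EuclideanSpace.single i 1] := fun i => by
    set e : Euc n := EuclideanSpace.single i 1
    have he : ‖e‖ = 1 := by simp [e]
    have hline : Continuous fun s : ℝ => x + s • e := by fun_prop
    have hmin : IsLocalMin (fun s : ℝ => f (x + s • e) + k * ‖x + s • e‖ ^ 2) 0 := by
      have ht : Filter.Tendsto (fun s : ℝ => x + s • e) (nhds 0) (nhds x) := by
        simpa using hline.tendsto 0
      filter_upwards [ht.eventually h] with s hs
      simpa using hs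
    have hfc := hf.continuous
    have := deriv_deriv_nonneg_of_isLocalMin hmin (by fun_prop)
    rw [deriv_deriv_add_sq_line hf, he] at this
    linarith
  calc -(2 * n * k) = ∑ _i : Fin n, -(2 * k) := by simp; ring
    _ ≤ _ := Finset.sum_le_sum fun i _ => key i

/-- Multiples of a decaying paraboloid are strict subsolutions lying below a positive solution. -/
theorem paraboloid_lt_of_isSolP {n : ℕ} {p : ℝ} (hp : 1 ≤ p) {u₀ : Euc n → ℝ} {u : Euc n → ℝ → ℝ}
    (hu : IsSolP n p u₀ u ⊤) (hupos : PosOn n u ⊤) {c r t₀ : ℝ} (hc : 0 < c) (hr : 0 < r)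
    (ht₀ : 0 < t₀) (hcr : 2 * n * p * c ^ p < r ^ 2)
    (h₀ : ∀ x, ‖x‖ ≤ r → t₀ ^ (-(1 / p)) * c < u₀ x) {x : Euc n} (hx : ‖x‖ ≤ r) {t : ℝ}
    (ht : 0 ≤ t) : (t + t₀) ^ (-(1 / p)) * c * (1 - ‖x‖ ^ 2 / r ^ 2) < u x t := by
  have hp0 : 0 < p := by linarith
  have hr2 : 0 < r ^ 2 := by positivity
  by_contra! hcon
  let z : Euc n × ℝ → ℝ := fun q =>
    u q.1 q.2 - (q.2 + t₀) ^ (-(1 / p)) * c * (1 - ‖q.1‖ ^ 2 / r ^ 2)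
  have hz : ContinuousOn z {q | 0 ≤ q.2} := by
    have h1 : ContinuousOn (fun q : Euc n × ℝ => u q.1 q.2) {q | 0 ≤ q.2} :=
      hu.cont.mono fun q hq => ⟨hq, ENNReal.ofReal_lt_top⟩
    have h2 : ContinuousOn (fun q : Euc n × ℝ => (q.2 + t₀) ^ (-(1 / p))) {q | 0 ≤ q.2} := by
      refine ContinuousOn.rpow_const (by fun_prop) fun q hq => Or.inl ?_
      have : 0 ≤ q.2 := hq
      positivity
    exact h1.sub ((h2.mul continuousOn_const).mul (by fun_prop))
  let S : Set (Euc n × ℝ) := Metric.closedBall 0 r ×ˢ Set.Icc 0 t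
  have hS : IsCompact S := (isCompact_closedBall _ _).prod isCompact_Icc
  have hK : IsCompact (S ∩ z ⁻¹' Set.Iic 0) :=
    hS.of_isClosed_subset ((hz.mono fun q hq => hq.2.1).preimage_isClosed_of_isClosed hS.isClosed
      isClosed_Iic) Set.inter_subset_left
  have hmem : (x, t) ∈ S ∩ z ⁻¹' Set.Iic 0 :=
    ⟨⟨by simpa using hx, ht, le_rfl⟩, by simpa [z] using hcon⟩
  obtain ⟨⟨y, τ⟩, ⟨⟨hy, hτ⟩, hyz⟩, hmin⟩ :=
    hK.exists_isMinOn ⟨_, hmem⟩ continuous_snd.continuousOn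
  replace hy : ‖y‖ ≤ r := by simpa using hy
  replace hyz : z (y, τ) ≤ 0 := hyz
  replace hτ : 0 ≤ τ ∧ τ ≤ t := hτ
  have hq1 : ∀ w : Euc n, 1 - ‖w‖ ^ 2 / r ^ 2 ≤ 1 := fun w => by
    have : 0 ≤ ‖w‖ ^ 2 / r ^ 2 := by positivity
    linarith
  have hτ0 : 0 < τ := by
    refine hτ.1.lt_of_ne' fun h => ?_
    subst h
    have h1 := h₀ y hy
    have h2 : t₀ ^ (-(1 / p)) * c * (1 - ‖y‖ ^ 2 / r ^ 2) ≤ t₀ ^ (-(1 / p)) * c :=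
      mul_le_of_le_one_right (by positivity) (hq1 y)
    simp only [z, hu.init, zero_add] at hyz
    linarith
  have hbefore : ∀ w : Euc n, ‖w‖ ≤ r → ∀ s, 0 ≤ s → s < τ → 0 < z (w, s) := by
    intro w hw s hs hsτ
    by_contra! hle
    have : τ ≤ s := hmin (show (w, s) ∈ S ∩ z ⁻¹' Set.Iic 0 from
      ⟨⟨by simpa using hw, hs, hsτ.le.trans hτ.2⟩, hle⟩)
    linarith
  have hat : ∀ w : Euc n, ‖w‖ ≤ r → 0 ≤ z (w, τ) := by
    intro w hw
    have h1 : ContinuousWithinAt (fun s => z (w, s)) (Set.Ici 0) τ :=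
      (hz.comp (f := fun s : ℝ => (w, s)) (s := Set.Ici 0) (by fun_prop) fun s hs => hs) τ hτ.1
    have h2 : Filter.Tendsto (fun s => z (w, s)) (nhdsWithin τ (Set.Iio τ)) (nhds (z (w, τ))) :=
      (h1.continuousAt (Ici_mem_nhds hτ0)).tendsto.mono_left nhdsWithin_le_nhds
    refine ge_of_tendsto h2 ?_
    filter_upwards [Ico_mem_nhdsLT hτ0] with s hs using (hbefore w hw s hs.1 hs.2).le
  have hzy : z (y, τ) = 0 := le_antisymm hyz (hat y hy)
  set q := 1 - ‖y‖ ^ 2 / r ^ 2 with hq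
  have hb : 0 < τ + t₀ := by positivity
  set f := (τ + t₀) ^ (-(1 / p)) with hf
  have hf0 : 0 < f := by positivity
  have huy : u y τ = f * c * q := by
    have : u y τ - f * c * q = 0 := hzy
    linarith
  have hu0 : 0 < u y τ := hupos y τ hτ.1 ENNReal.ofReal_lt_top
  have hq0 : 0 < q := by
    rw [huy] at hu0
    exact pos_of_mul_pos_right hu0 (by positivity)
  have hyr : ‖y‖ < r := by
    have : ‖y‖ ^ 2 / r ^ 2 < 1 := by linarith
    rw [div_lt_one hr2] at this
    exact lt_of_pow_lt_pow_left₀ 2 hr.le this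
  have hlap : -(2 * n * (f * c / r ^ 2)) ≤ lap n (fun w => u w τ) y := by
    refine neg_two_mul_le_lap_of_isLocalMin (hu.reg_space τ hτ0 ENNReal.ofReal_lt_top) ?_
    filter_upwards [Metric.isOpen_ball.mem_nhds (mem_ball_zero_iff.2 hyr)] with w hw
    have h1 : 0 ≤ u w τ - f * c * (1 - ‖w‖ ^ 2 / r ^ 2) := hat w (mem_ball_zero_iff.1 hw).le
    have h2 : ∀ a : ℝ, f * c / r ^ 2 * a = f * c - f * c * (1 - a / r ^ 2) := fun a => by ring
    rw [h2, h2, huy]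
    linarith
  have hv : HasDerivAt (fun s : ℝ => (s + t₀) ^ (-(1 / p)) * c * q)
      (-(1 / p) * (f * (τ + t₀)⁻¹) * c * q) τ := by
    have h1 := (((hasDerivAt_id τ).add_const t₀).rpow_const (p := -(1 / p))
      (Or.inl hb.ne')).mul_const c |>.mul_const q
    have h2 : (τ + t₀) ^ (-(1 / p) - 1) = f * (τ + t₀)⁻¹ := by
      rw [Real.rpow_sub hb, Real.rpow_one, div_eq_mul_inv]
    refine h1.congr_deriv ?_
    rw [id_eq, h2]
    ring
  have hdu := hu.reg_time y τ hτ0 ENNReal.ofReal_lt_top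
  have hdz := deriv_nonpos_of_forall_lt_ge hτ0 (hdu.sub hv.differentiableAt)
    (fun s hs hsτ => by
      have h1 : z (y, τ) ≤ z (y, s) := hzy.le.trans (hbefore y hy s hs hsτ).le
      exact h1)
  rw [deriv_sub hdu hv.differentiableAt, hv.deriv, hu.pde y τ hτ0 ENNReal.ofReal_lt_top] at hdz
  have hup : u y τ ^ p = (τ + t₀)⁻¹ * c ^ p * q ^ p := by
    rw [huy, Real.mul_rpow (by positivity) hq0.le, Real.mul_rpow hf0.le hc.le, hf,
      ← Real.rpow_mul hb.le, neg_mul, one_div_mul_cancel hp0.ne', Real.rpow_neg_one]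
  have hqp : q ^ p ≤ q := by
    simpa using Real.rpow_le_rpow_of_exponent_ge hq0 (hq1 y) hp
  have hlow : -((τ + t₀)⁻¹ * c ^ p * q * (2 * n * (f * c / r ^ 2)))
      ≤ u y τ ^ p * lap n (fun w => u w τ) y := by
    have h1 : u y τ ^ p ≤ (τ + t₀)⁻¹ * c ^ p * q := by
      rw [hup]
      gcongr
    have h2 : 0 ≤ 2 * n * (f * c / r ^ 2) := by positivity
    have h3 := mul_le_mul_of_nonneg_right h1 h2
    have h4 := mul_le_mul_of_nonneg_left hlap (Real.rpow_nonneg hu0.le p)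
    linarith
  have hstrict : (τ + t₀)⁻¹ * c ^ p * q * (2 * n * (f * c / r ^ 2))
      < 1 / p * (f * (τ + t₀)⁻¹) * c * q := by
    have h1 : 2 * n * p * c ^ p / r ^ 2 < 1 := (div_lt_one hr2).2 hcr
    have h2 : 0 < 1 / p * (f * (τ + t₀)⁻¹) * c * q := by positivity
    calc (τ + t₀)⁻¹ * c ^ p * q * (2 * n * (f * c / r ^ 2))
        = 1 / p * (f * (τ + t₀)⁻¹) * c * q * (2 * n * p * c ^ p / r ^ 2) := by field_simp
      _ < 1 / p * (f * (τ + t₀)⁻¹) * c * q * 1 := by gcongr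
      _ = _ := mul_one _
  linarith

/-- Proposition: for any global positive classical solution `u` of (P) and any `R > 0`,
`inf_{|x|<R} t^{1/p} u(x,t) → ∞` as `t → ∞`. -/
theorem stmt4 (n : ℕ) (hn : 1 ≤ n) (p : ℝ) (hp : 1 ≤ p)
    (u₀ : Euc n → ℝ) (hcont : Continuous u₀) (hpos : ∀ x, 0 < u₀ x)
    (u : Euc n → ℝ → ℝ) (hu : IsSolP n p u₀ u ⊤) (hupos : PosOn n u ⊤) :
    ∀ R : ℝ, 0 < R → ∀ M : ℝ, 0 < M → ∃ T : ℝ, 0 < T ∧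
      ∀ t : ℝ, T ≤ t → ∀ x : Euc n, ‖x‖ < R → M ≤ t ^ (1 / p) * u x t := by
  intro R hR M hM
  have hp0 : 0 < p := by linarith
  set c : ℝ := 4 * M
  have hc : 0 < c := by positivity
  obtain ⟨r, hrR, hr1, hr⟩ : ∃ r : ℝ, 2 * R ≤ r ∧ 1 ≤ r ∧ 2 * n * p * c ^ p < r := by
    refine ⟨2 * R + 1 + 2 * n * p * c ^ p, ?_, ?_, ?_⟩ <;>
    have : 0 ≤ 2 * n * p * c ^ p := by positivity
    all_goals linarith
  have hr0 : 0 < r := by linarith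
  have hcr : 2 * n * p * c ^ p < r ^ 2 := hr.trans_le (le_self_pow₀ hr1 two_ne_zero)
  obtain ⟨x₀, -, hx₀⟩ := (isCompact_closedBall (0 : Euc n) r).exists_isMinOn
    ⟨0, by simp [hr0.le]⟩ hcont.continuousOn
  have hlim : Filter.Tendsto (fun s : ℝ => s ^ (-(1 / p)) * c) Filter.atTop (nhds 0) := by
    simpa using (tendsto_rpow_neg_atTop (one_div_pos.2 hp0)).mul_const c
  obtain ⟨t₀, ht₀, ht₀0⟩ :=
    ((hlim.eventually_lt_const (hpos x₀)).and (Filter.eventually_gt_atTop 0)).exists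
  refine ⟨t₀, ht₀0, fun t ht x hx => ?_⟩
  have ht0 : 0 < t := by linarith
  have hlt := paraboloid_lt_of_isSolP hp hu hupos hc hr0 ht₀0 hcr
    (fun y hy => ht₀.trans_le (hx₀ (mem_closedBall_zero_iff.2 hy)))
    (x := x) (by linarith) ht0.le
  have hq : 1 / 2 ≤ 1 - ‖x‖ ^ 2 / r ^ 2 := by
    have : ‖x‖ ^ 2 / r ^ 2 ≤ 1 / 2 := by
      rw [div_le_iff₀ (by positivity)]
      nlinarith [norm_nonneg x]
    linarith
  have hratio : 1 / 2 ≤ t ^ (1 / p) * (t + t₀) ^ (-(1 / p)) := by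
    rw [Real.rpow_neg (by positivity), ← div_eq_mul_inv, ← Real.div_rpow ht0.le (by positivity)]
    have h1 : 1 / 2 ≤ t / (t + t₀) := by
      rw [div_le_div_iff₀ (by norm_num) (by positivity)]
      linarith
    calc (1 / 2 : ℝ) = (1 / 2) ^ (1 : ℝ) := (Real.rpow_one _).symm
      _ ≤ (1 / 2) ^ (1 / p) := Real.rpow_le_rpow_of_exponent_ge (by norm_num) (by norm_num)
          ((div_le_one hp0).2 hp)
      _ ≤ _ := Real.rpow_le_rpow (by norm_num) h1 (by positivity)
  calc M = 1 / 2 * c * (1 / 2) := by simp only [c]; ring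
    _ ≤ t ^ (1 / p) * (t + t₀) ^ (-(1 / p)) * c * (1 - ‖x‖ ^ 2 / r ^ 2) := by gcongr
    _ = t ^ (1 / p) * ((t + t₀) ^ (-(1 / p)) * c * (1 - ‖x‖ ^ 2 / r ^ 2)) := by ring
    _ ≤ t ^ (1 / p) * u x t := by gcongr
end
end

section
/- Let n ≥ 1, p ≥ 1 and q₀ > 0, and let q ∈ (q₀, ∞]. Then there exists a continuous, bounded, everywhere positive function u₀ : ℝⁿ → ℝ with u₀ ∈ L^{q₀}(ℝⁿ) such that for every δ > 0 one can find C(δ) > 0 with the property that every global positive classical solution u of the Cauchy problem (P) with initial data u₀ satisfies ‖u(·,t)‖_{L^q(ℝⁿ)} ≥ C(δ) · t^{−(1−q₀/q)/(p+2q₀/n)−δ} for all t > 1 (for q = ∞ the factor q₀/q is interpreted as 0). -/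
open MeasureTheory
open scoped ENNReal
noncomputable section

open Filter Topology in
lemma IsLocalMin.deriv_deriv_nonneg {f : ℝ → ℝ} {a : ℝ} (h : IsLocalMin f a)
    (hf : ContinuousAt f a) : 0 ≤ deriv (deriv f) a := by
  by_contra! hneg
  have hmax : IsLocalMax f a := isLocalMax_of_deriv_deriv_neg hneg h.deriv_eq_zero hf
  have heq : f =ᶠ[𝓝 a] fun _ => f a := by
    filter_upwards [h, hmax] with y h₁ h₂ using le_antisymm h₂ h₁
  have := heq.deriv.deriv.eq_of_nhds
  simp at this
  linarith

lemma IsLocalMin.iteratedFDeriv_two_ge {E : Type*} [NormedAddCommGroup E] [InnerProductSpace ℝ E]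
    {G : E → ℝ} (hG : ContDiff ℝ 2 G) {c : ℝ} {x : E}
    (h : IsLocalMin (fun y => G y + c * ‖y‖ ^ 2) x) (e : E) :
    -(2 * c * ‖e‖ ^ 2) ≤ iteratedFDeriv ℝ 2 G x ![e, e] := by
  have hline : ∀ s : ℝ, HasDerivAt (fun s : ℝ => x + s • e) e s := fun s => by
    simpa using ((hasDerivAt_id s).smul_const e).const_add x
  have hquad : ∀ s : ℝ, ‖x + s • e‖ ^ 2 = ‖x‖ ^ 2 + 2 * s * inner ℝ x e + s ^ 2 * ‖e‖ ^ 2 := by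
    intro s
    rw [norm_add_sq_real, inner_smul_right, norm_smul, mul_pow, Real.norm_eq_abs, sq_abs]
    ring
  set g : ℝ → ℝ := fun s => G (x + s • e) +
    c * (‖x‖ ^ 2 + 2 * s * inner ℝ x e + s ^ 2 * ‖e‖ ^ 2) with hg
  have hgd : ∀ s, HasDerivAt g
      (fderiv ℝ G (x + s • e) e + c * (2 * inner ℝ x e + 2 * s * ‖e‖ ^ 2)) s := by
    intro s
    have h₁ := ((hG.differentiable (by norm_num)) (x + s • e)).hasFDerivAt.comp_hasDerivAt s (hline s)
    have h₂ : HasDerivAt (fun s : ℝ => c * (‖x‖ ^ 2 + 2 * s * inner ℝ x e + s ^ 2 * ‖e‖ ^ 2))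
        (c * (2 * inner ℝ x e + 2 * s * ‖e‖ ^ 2)) s := by
      have := ((((hasDerivAt_id s).const_mul 2).mul_const (inner ℝ x e)).const_add (‖x‖ ^ 2)).add
        (((hasDerivAt_id s).pow 2).mul_const (‖e‖ ^ 2))
      convert! this.const_mul c using 1
      simp
    exact h₁.add h₂
  have hmin : IsLocalMin g 0 := by
    have hc : Filter.Tendsto (fun s : ℝ => x + s • e) (nhds 0) (nhds x) := by
      have := (hline 0).continuousAt.tendsto
      simpa using this
    have := hc.eventually h
    filter_upwards [this] with s hs
    rw [hquad] at hs
    simpa [hg] using hs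
  have key := hmin.deriv_deriv_nonneg (hgd 0).continuousAt
  have hd : deriv g = fun s => fderiv ℝ G (x + s • e) e + c * (2 * inner ℝ x e + 2 * s * ‖e‖ ^ 2) :=
    funext fun s => (hgd s).deriv
  have hdd : HasDerivAt (deriv g) (fderiv ℝ (fderiv ℝ G) x e e + c * (2 * ‖e‖ ^ 2)) 0 := by
    rw [hd]
    have hF : DifferentiableAt ℝ (fderiv ℝ G) (x + (0 : ℝ) • e) :=
      (hG.fderiv_right (m := 1) (by norm_num)).differentiable (by norm_num) _
    have h₁ : HasDerivAt (fun s : ℝ => fderiv ℝ G (x + s • e) e)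
        (fderiv ℝ (fderiv ℝ G) x e e) 0 := by
      have h := hF.hasFDerivAt.comp_hasDerivAt (0 : ℝ) (hline 0)
      rw [zero_smul, add_zero] at h
      have h' := (ContinuousLinearMap.apply ℝ ℝ e).hasFDerivAt.comp_hasDerivAt (0 : ℝ) h
      exact h'
    have h₂ : HasDerivAt (fun s : ℝ => c * (2 * inner ℝ x e + 2 * s * ‖e‖ ^ 2))
        (c * (2 * ‖e‖ ^ 2)) 0 := by
      have := ((((hasDerivAt_id (0 : ℝ)).const_mul 2).mul_const (‖e‖ ^ 2)).const_add
        (2 * inner ℝ x e)).const_mul c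
      simpa using this
    exact h₁.add h₂
  rw [hdd.deriv] at key
  rw [iteratedFDeriv_two_apply]
  simp only [Matrix.cons_val_zero, Matrix.cons_val_one]
  linarith

lemma IsLocalMin.lap_ge {n : ℕ} {G : Euc n → ℝ} (hG : ContDiff ℝ 2 G) {c : ℝ} {x : Euc n}
    (h : IsLocalMin (fun y => G y + c * ‖y‖ ^ 2) x) : -(2 * n * c) ≤ lap n G x := by
  have : ∑ _i : Fin n, -(2 * c) ≤ lap n G x := by
    refine Finset.sum_le_sum fun i _ => ?_
    simpa using h.iteratedFDeriv_two_ge hG (EuclideanSpace.single i (1 : ℝ))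
  simp at this
  linarith

open Filter Topology in
lemma HasDerivAt.nonpos_of_left_nonneg {f : ℝ → ℝ} {f' a : ℝ} (hf : HasDerivAt f f' a)
    (h : ∀ᶠ s in 𝓝[<] a, f a ≤ f s) : f' ≤ 0 := by
  have ht := hasDerivWithinAt_iff_tendsto_slope' (s := Set.Iio a) (by simp) |>.1
    hf.hasDerivWithinAt
  refine le_of_tendsto ht ?_
  filter_upwards [h, self_mem_nhdsWithin] with s hs hlt
  rw [slope_def_field]
  exact div_nonpos_of_nonneg_of_nonpos (by linarith) (by have : s < a := hlt; linarith)

/-- Comparison of a positive solution with the separated subsolution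
`A e^{-λ t} (1 - |x|² / R²)` supported in a ball. -/
lemma IsSolP.exp_mul_le {n : ℕ} {p : ℝ} (hp : 1 ≤ p) {u₀ : Euc n → ℝ} {u : Euc n → ℝ → ℝ}
    (hu : IsSolP n p u₀ u ⊤) (hpos : PosOn n u ⊤) {A R : ℝ} (hA : 0 < A) (hR : 0 < R)
    (h₀ : ∀ x, ‖x‖ ≤ R → A < u₀ x) {x : Euc n} (hx : ‖x‖ ≤ R) {t : ℝ} (ht : 0 ≤ t) :
    A * Real.exp (-((2 * n + 1) * A ^ p / R ^ 2 * t)) * (1 - ‖x‖ ^ 2 / R ^ 2) < u x t := by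
  set L : ℝ := (2 * n + 1) * A ^ p / R ^ 2 with hL
  have hAp : 0 < A ^ p := Real.rpow_pos_of_pos hA p
  have hLpos : 0 < L := by positivity
  set w : Euc n × ℝ → ℝ := fun z =>
    u z.1 z.2 - A * Real.exp (-(L * z.2)) * (1 - ‖z.1‖ ^ 2 / R ^ 2) with hw
  by_contra! hle
  have hwc : ContinuousOn w {z : Euc n × ℝ | 0 ≤ z.2} := by
    refine ContinuousOn.sub ?_ (by fun_prop)
    refine hu.cont.mono fun z hz => ?_
    exact ⟨hz, ENNReal.ofReal_lt_top⟩
  set K : Set (Euc n × ℝ) := Metric.closedBall 0 R ×ˢ Set.Icc 0 t with hK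
  have hKc : IsCompact K := (isCompact_closedBall _ _).prod isCompact_Icc
  have hKsub : K ⊆ {z | 0 ≤ z.2} := fun z hz => hz.2.1
  have hSc : IsCompact (K ∩ w ⁻¹' Set.Iic 0) := by
    refine hKc.of_isClosed_subset ?_ Set.inter_subset_left
    exact (hwc.mono hKsub).preimage_isClosed_of_isClosed hKc.isClosed isClosed_Iic
  have hSne : (K ∩ w ⁻¹' Set.Iic 0).Nonempty := by
    refine ⟨(x, t), ⟨by simpa using hx, ht, le_rfl⟩, ?_⟩
    simp only [hw, Set.mem_preimage, Set.mem_Iic]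
    linarith
  obtain ⟨⟨x₀, t₀⟩, ⟨hz₀K, hz₀⟩, hmin⟩ := hSc.exists_isMinOn hSne continuous_snd.continuousOn
  have hx₀R : ‖x₀‖ ≤ R := by simpa using hz₀K.1
  have ht₀n : 0 ≤ t₀ := hz₀K.2.1
  have ht₀t : t₀ ≤ t := hz₀K.2.2
  have hz₀' : w (x₀, t₀) ≤ 0 := hz₀
  have hbefore : ∀ y : Euc n, ‖y‖ ≤ R → ∀ s, 0 ≤ s → s < t₀ → 0 < w (y, s) := by
    intro y hy s hs hst
    by_contra! hneg
    have := hmin (show (y, s) ∈ K ∩ w ⁻¹' Set.Iic 0 from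
      ⟨⟨by simpa using hy, hs, by linarith⟩, hneg⟩)
    have h' : t₀ ≤ s := this
    linarith
  have ht₀ : 0 < t₀ := by
    rcases ht₀n.lt_or_eq with h | h
    · exact h
    · exfalso
      have h1 := h₀ x₀ hx₀R
      rw [← hu.init x₀, h] at h1
      have h2 : 0 ≤ ‖x₀‖ ^ 2 / R ^ 2 := by positivity
      simp only [hw, ← h] at hz₀'
      rw [← h] at h1
      simp at hz₀'
      nlinarith
  have hupos : 0 < u x₀ t₀ := hpos x₀ t₀ ht₀.le ENNReal.ofReal_lt_top
  have hlim : ∀ y : Euc n, ‖y‖ ≤ R → 0 ≤ w (y, t₀) := by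
    intro y hy
    have hc : ContinuousWithinAt (fun s => w (y, s)) (Set.Icc 0 t₀) t₀ := by
      have h1 : ContinuousOn (fun s => w (y, s)) (Set.Icc 0 t₀) :=
        hwc.comp (by fun_prop) fun s hs => hs.1
      exact h1 t₀ ⟨ht₀.le, le_rfl⟩
    have hc' : Filter.Tendsto (fun s => w (y, s)) (nhdsWithin t₀ (Set.Iio t₀))
        (nhds (w (y, t₀))) := by
      refine hc.tendsto.mono_left ?_
      rw [← nhdsWithin_Ico_eq_nhdsLT ht₀]
      exact nhdsWithin_mono _ Set.Ico_subset_Icc_self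
    refine ge_of_tendsto hc' ?_
    filter_upwards [Ico_mem_nhdsLT ht₀] with s hs using (hbefore y hy s hs.1 hs.2).le
  have hzero : w (x₀, t₀) = 0 := le_antisymm hz₀' (hlim x₀ hx₀R)
  set B : ℝ := A * Real.exp (-(L * t₀)) with hB
  have hBpos : 0 < B := by positivity
  have hBA : B ≤ A := by
    have : Real.exp (-(L * t₀)) ≤ 1 := Real.exp_le_one_iff.2 (by nlinarith)
    nlinarith
  set φ : ℝ := 1 - ‖x₀‖ ^ 2 / R ^ 2 with hφ
  have huv : u x₀ t₀ = B * φ := by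
    have : u x₀ t₀ - B * φ = 0 := hzero
    linarith
  have hφpos : 0 < φ := by
    by_contra! hneg
    nlinarith
  have hφ1 : φ ≤ 1 := by
    have : 0 ≤ ‖x₀‖ ^ 2 / R ^ 2 := by positivity
    linarith
  have hx₀lt : ‖x₀‖ < R := by
    rcases hx₀R.lt_or_eq with h | h
    · exact h
    · rw [hφ, h, div_self (by positivity)] at hφpos
      simp at hφpos
  have hlocal : IsLocalMin (fun y => u y t₀ + B / R ^ 2 * ‖y‖ ^ 2) x₀ := by
    have : Metric.ball (0 : Euc n) R ∈ nhds x₀ := Metric.isOpen_ball.mem_nhds (by simpa using hx₀lt)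
    filter_upwards [this] with y hy
    have hy' : ‖y‖ ≤ R := by
      have := Metric.mem_ball.1 hy
      rw [dist_zero_right] at this
      exact this.le
    have h1 : 0 ≤ u y t₀ - B * (1 - ‖y‖ ^ 2 / R ^ 2) := hlim y hy'
    have h2 : u x₀ t₀ - B * (1 - ‖x₀‖ ^ 2 / R ^ 2) = 0 := hzero
    have e1 : B / R ^ 2 * ‖y‖ ^ 2 = B * (‖y‖ ^ 2 / R ^ 2) := by ring
    have e2 : B / R ^ 2 * ‖x₀‖ ^ 2 = B * (‖x₀‖ ^ 2 / R ^ 2) := by ring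
    rw [e1, e2]
    linarith
  have hlap := hlocal.lap_ge (hu.reg_space t₀ ht₀ ENNReal.ofReal_lt_top)
  have hderiv : deriv (u x₀) t₀ + L * B * φ ≤ 0 := by
    have h1 := (hu.reg_time x₀ t₀ ht₀ ENNReal.ofReal_lt_top).hasDerivAt
    have h2 : HasDerivAt (fun s => A * Real.exp (-(L * s)) * φ) (-(L * B * φ)) t₀ := by
      have := ((((hasDerivAt_id t₀).const_mul L).neg.exp).const_mul A).mul_const φ
      convert! this using 1
      simp only [Pi.neg_apply, id_eq, hB]
      ring
    have h3 := (h1.sub h2).nonpos_of_left_nonneg (by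
      filter_upwards [Ico_mem_nhdsLT ht₀] with s hs
      have h4 : 0 < w (x₀, s) := hbefore x₀ hx₀R s hs.1 hs.2
      have h5 : w (x₀, t₀) ≤ w (x₀, s) := by rw [hzero]; exact h4.le
      exact h5)
    linarith
  rw [hu.pde x₀ t₀ ht₀ ENNReal.ofReal_lt_top, huv] at hderiv
  have hpow : (B * φ) ^ p ≤ A ^ p * φ := by
    rw [Real.mul_rpow hBpos.le hφpos.le]
    exact mul_le_mul (Real.rpow_le_rpow hBpos.le hBA (by linarith))
      (Real.rpow_le_self_of_le_one hφpos.le hφ1 hp) (by positivity) hAp.le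
  have hvp : 0 ≤ (B * φ) ^ p := by positivity
  have h1 : -((B * φ) ^ p * (2 * n * (B / R ^ 2))) ≤
      (B * φ) ^ p * lap n (fun y => u y t₀) x₀ := by
    have := mul_le_mul_of_nonneg_left hlap hvp
    linarith
  have h2 : (B * φ) ^ p * (2 * n * (B / R ^ 2)) ≤ A ^ p * φ * (2 * n * (B / R ^ 2)) :=
    mul_le_mul_of_nonneg_right hpow (by positivity)
  have h3 : L * B * φ = A ^ p * φ * (2 * n * (B / R ^ 2)) + A ^ p * φ * (B / R ^ 2) := by
    rw [hL]; ring
  have h4 : 0 < A ^ p * φ * (B / R ^ 2) := by positivity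
  linarith

/-- A radial function that barely fails to have critical decay for `L^{q₀}`. -/
def slowDecay (n : ℕ) (q₀ : ℝ) (x : Euc n) : ℝ :=
  ((3 + ‖x‖) ^ n * Real.log (3 + ‖x‖) ^ 2) ^ (-(1 / q₀))

lemma one_le_log_three_add {r : ℝ} (hr : 0 ≤ r) : 1 ≤ Real.log (3 + r) := by
  rw [Real.le_log_iff_exp_le (by linarith)]
  linarith [Real.exp_one_lt_three]

lemma one_le_pow_mul_log_sq (n : ℕ) {r : ℝ} (hr : 0 ≤ r) :
    1 ≤ (3 + r) ^ n * Real.log (3 + r) ^ 2 :=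
  one_le_mul_of_one_le_of_one_le (one_le_pow₀ (by linarith)) (one_le_pow₀ (one_le_log_three_add hr))

lemma slowDecay_pos (n : ℕ) (q₀ : ℝ) (x : Euc n) : 0 < slowDecay n q₀ x :=
  Real.rpow_pos_of_pos (by linarith [one_le_pow_mul_log_sq n (norm_nonneg x)]) _

lemma slowDecay_le_one (n : ℕ) {q₀ : ℝ} (hq₀ : 0 < q₀) (x : Euc n) : slowDecay n q₀ x ≤ 1 :=
  Real.rpow_le_one_of_one_le_of_nonpos (one_le_pow_mul_log_sq n (norm_nonneg x))
    (by simpa using hq₀.le)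

lemma continuous_slowDecay (n : ℕ) (q₀ : ℝ) : Continuous (slowDecay n q₀) := by
  unfold slowDecay
  refine Continuous.rpow_const ?_ fun x =>
    Or.inl (by linarith [one_le_pow_mul_log_sq n (norm_nonneg x)])
  refine Continuous.mul (by fun_prop) (Continuous.pow (Continuous.log (by fun_prop) fun x => ?_) 2)
  positivity

lemma integrable_inv_pow_mul_log_sq {n : ℕ} (hn : 1 ≤ n) :
    Integrable (fun x : Euc n => ((3 + ‖x‖) ^ n * Real.log (3 + ‖x‖) ^ 2)⁻¹) volume := by
  have : Nonempty (Fin n) := ⟨⟨0, hn⟩⟩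
  have hlim : Filter.Tendsto (fun r : ℝ => -(Real.log (3 + r))⁻¹) Filter.atTop (nhds 0) := by
    have h1 : Filter.Tendsto (fun r : ℝ => 3 + r) Filter.atTop Filter.atTop :=
      Filter.tendsto_atTop_add_const_left _ _ Filter.tendsto_id
    simpa using ((Real.tendsto_log_atTop.comp h1).inv_tendsto_atTop).neg
  have hint : IntegrableOn (fun r : ℝ => (3 + r)⁻¹ / Real.log (3 + r) ^ 2) (Set.Ioi 0) := by
    refine integrableOn_Ioi_deriv_of_nonneg' (fun r hr => ?_) (fun r hr => ?_) hlim
    · have hr' : (0 : ℝ) ≤ r := hr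
      have h1 : HasDerivAt (fun r : ℝ => Real.log (3 + r)) (3 + r)⁻¹ r := by
        simpa using ((hasDerivAt_id r).const_add 3).log (by simp; linarith)
      have h2 := (h1.inv (by linarith [one_le_log_three_add hr'])).neg
      convert! h2 using 1
      ring
    · have hr' : (0 : ℝ) < r := hr
      positivity
  refine (integrable_fun_norm_addHaar (volume : Measure (Euc n))
    (f := fun r => ((3 + r) ^ n * Real.log (3 + r) ^ 2)⁻¹)).2 ?_
  refine hint.mono' (by fun_prop) ?_
  filter_upwards [ae_restrict_mem measurableSet_Ioi] with r hr
  have hr' : (0 : ℝ) < r := hr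
  have hlog := one_le_log_three_add hr'.le
  rw [Real.norm_of_nonneg (by positivity), finrank_euclideanSpace_fin, smul_eq_mul]
  obtain ⟨m, rfl⟩ : ∃ m, n = m + 1 := ⟨n - 1, by omega⟩
  rw [Nat.add_sub_cancel]
  calc r ^ m * ((3 + r) ^ (m + 1) * Real.log (3 + r) ^ 2)⁻¹
      ≤ (3 + r) ^ m * ((3 + r) ^ (m + 1) * Real.log (3 + r) ^ 2)⁻¹ := by
        gcongr
        linarith
    _ = (3 + r)⁻¹ / Real.log (3 + r) ^ 2 := by
        field_simp
        ring

lemma eLpNorm_slowDecay_lt_top {n : ℕ} (hn : 1 ≤ n) {q₀ : ℝ} (hq₀ : 0 < q₀) :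
    eLpNorm (slowDecay n q₀) (ENNReal.ofReal q₀) volume < ⊤ := by
  rw [eLpNorm_lt_top_iff_lintegral_rpow_enorm_lt_top (by simpa using hq₀) ENNReal.ofReal_ne_top,
    ENNReal.toReal_ofReal hq₀.le]
  convert! (integrable_inv_pow_mul_log_sq hn).lintegral_lt_top using 3 with x
  have h1 := one_le_pow_mul_log_sq n (norm_nonneg x)
  rw [Real.enorm_of_nonneg (slowDecay_pos n q₀ x).le,
    ENNReal.ofReal_rpow_of_pos (slowDecay_pos n q₀ x), slowDecay,
    ← Real.rpow_mul (by linarith), neg_mul, one_div_mul_cancel hq₀.ne', Real.rpow_neg_one]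

lemma exists_lt_slowDecay (n : ℕ) {q₀ ε : ℝ} (hq₀ : 0 < q₀) (hε : 0 < ε) :
    ∃ c : ℝ, 0 < c ∧ c ≤ 1 ∧ ∀ R : ℝ, 1 ≤ R → ∀ x : Euc n, ‖x‖ ≤ R →
      c * R ^ (-(n / q₀ + ε)) < slowDecay n q₀ x := by
  set η : ℝ := ε * q₀ / 2 with hη
  have hηpos : 0 < η := by positivity
  set d : ℝ := (4 ^ (n + 2 * η) * (η ^ 2)⁻¹) ^ (-(1 / q₀)) with hd
  have hdpos : 0 < d := by positivity
  have key : ∀ R : ℝ, 1 ≤ R → ∀ x : Euc n, ‖x‖ ≤ R →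
      d * R ^ (-(n / q₀ + ε)) ≤ slowDecay n q₀ x := by
    intro R hR x hx
    have hx0 := norm_nonneg x
    have hlog := one_le_log_three_add hx0
    have hRpos : 0 < R := by linarith
    have h1 : (3 + ‖x‖) ^ n * Real.log (3 + ‖x‖) ^ 2 ≤
        (4 ^ (n + 2 * η) * (η ^ 2)⁻¹) * R ^ (n + 2 * η) := by
      calc (3 + ‖x‖) ^ n * Real.log (3 + ‖x‖) ^ 2
          ≤ (4 * R) ^ n * ((4 * R) ^ η / η) ^ 2 := by
            have h2 : Real.log (3 + ‖x‖) ≤ (4 * R) ^ η / η :=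
              (Real.log_le_rpow_div (by positivity) hηpos).trans (by gcongr; linarith)
            have h3 : 3 + ‖x‖ ≤ 4 * R := by linarith
            gcongr
        _ = (η ^ 2)⁻¹ * (4 * R) ^ (n + 2 * η) := by
            rw [Real.rpow_add (by positivity), Real.rpow_natCast, two_mul,
              Real.rpow_add (by positivity)]
            field_simp
        _ = _ := by
            rw [Real.mul_rpow (by norm_num) hRpos.le]; ring
    have h4 := Real.rpow_le_rpow_of_nonpos (by
      linarith [one_le_pow_mul_log_sq n hx0]) h1 (show -(1 / q₀) ≤ 0 by simpa using hq₀.le)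
    rw [Real.mul_rpow (by positivity) (by positivity), ← Real.rpow_mul hRpos.le] at h4
    have h5 : (n + 2 * η) * -(1 / q₀) = -(n / q₀ + ε) := by
      rw [hη]; field_simp
    rw [h5] at h4
    exact h4
  refine ⟨min (d / 2) 1, by positivity, min_le_right _ _, fun R hR x hx => ?_⟩
  refine lt_of_lt_of_le ?_ (key R hR x hx)
  have : min (d / 2) 1 < d := (min_le_left _ _).trans_lt (by linarith)
  gcongr

lemma eLpNorm_ge_of_ball {n : ℕ} {f : Euc n → ℝ} {q : ℝ≥0∞} (hq : q ≠ 0) {a r : ℝ} (ha : 0 ≤ a)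
    (hr : 0 < r) (hf : ∀ x, ‖x‖ < r → a ≤ f x) :
    ENNReal.ofReal (a * (r ^ n * volume.real (Metric.ball (0 : Euc n) 1)) ^ (1 / q.toReal)) ≤
      eLpNorm f q volume := by
  have hmono : eLpNorm ((Metric.ball (0 : Euc n) r).indicator fun _ => a) q volume ≤
      eLpNorm f q volume := by
    refine eLpNorm_mono fun x => ?_
    by_cases hx : x ∈ Metric.ball (0 : Euc n) r
    · rw [Set.indicator_of_mem hx, Real.norm_of_nonneg ha]
      exact (hf x (by simpa using hx)).trans (Real.le_norm_self _)
    · simp [Set.indicator_of_notMem hx]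
  refine le_trans (le_of_eq ?_) hmono
  rw [eLpNorm_indicator_const' measurableSet_ball (Metric.measure_ball_pos _ _ hr).ne' hq,
    Measure.addHaar_ball_of_pos _ _ hr, finrank_euclideanSpace_fin, ENNReal.ofReal_mul ha,
    Real.enorm_of_nonneg ha,
    ← ENNReal.ofReal_rpow_of_nonneg (by positivity) (by positivity),
    ENNReal.ofReal_mul (by positivity), ofReal_measureReal measure_ball_lt_top.ne]

/-- Theorem (optimality of the decay rates): for every `q₀ > 0` and `q ∈ (q₀,∞]` there are
initial data `u₀ ∈ L^{q₀}(ℝⁿ)` such that every global positive classical solution of (P)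
satisfies `‖u(·,t)‖_{L^q} ≥ C(δ) t^{-(1-q₀/q)/(p+2q₀/n)-δ}` for all `t > 1` and each `δ > 0`.
(For `q = ∞` the quotient `q₀/q`, encoded as `q₀ / q.toReal`, is `0`.) -/
theorem stmt5 (n : ℕ) (hn : 1 ≤ n) (p q₀ : ℝ) (hp : 1 ≤ p) (hq₀ : 0 < q₀)
    (q : ℝ≥0∞) (hq : ENNReal.ofReal q₀ < q) :
    ∃ u₀ : Euc n → ℝ, Continuous u₀ ∧ BddAbove (Set.range u₀) ∧ (∀ x, 0 < u₀ x) ∧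
      eLpNorm u₀ (ENNReal.ofReal q₀) volume < ⊤ ∧
      ∀ δ : ℝ, 0 < δ → ∃ C : ℝ, 0 < C ∧
        ∀ u : Euc n → ℝ → ℝ, IsSolP n p u₀ u ⊤ → PosOn n u ⊤ →
          ∀ t : ℝ, 1 < t →
            ENNReal.ofReal (C * t ^ (-((1 - q₀ / q.toReal) / (p + 2 * q₀ / (n : ℝ))) - δ)) ≤
              eLpNorm (fun x => u x t) q volume := by
  refine ⟨slowDecay n q₀, continuous_slowDecay n q₀,
    ⟨1, by rintro _ ⟨x, rfl⟩; exact slowDecay_le_one n hq₀ x⟩, slowDecay_pos n q₀,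
    eLpNorm_slowDecay_lt_top hn hq₀, fun δ hδ => ?_⟩
  have hnpos : (0 : ℝ) < n := by exact_mod_cast hn
  have hp0 : 0 < p := by linarith
  have hq0 : q ≠ 0 := (bot_le.trans_lt hq).ne'
  set a : ℝ := 1 / (2 + n * p / q₀) with ha
  have hapos : 0 < a := by positivity
  set ε : ℝ := δ / a with hε
  have hεpos : 0 < ε := by positivity
  obtain ⟨c, hc, hc1, hlow⟩ := exists_lt_slowDecay n hq₀ hεpos
  set V : ℝ := volume.real (Metric.ball (0 : Euc n) 1) with hV
  have hVpos : 0 < V := ENNReal.toReal_pos (Metric.measure_ball_pos _ _ one_pos).ne'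
    measure_ball_lt_top.ne
  set r : ℝ := 1 / q.toReal with hr
  refine ⟨c * Real.exp (-(2 * n + 1)) * (3 / 4) * ((1 / 2) ^ n * V) ^ r, by positivity,
    fun u hu hpos t ht => ?_⟩
  have ht0 : 0 < t := by linarith
  set R : ℝ := t ^ a with hR
  have hR1 : 1 ≤ R := Real.one_le_rpow ht.le hapos.le
  have hRpos : 0 < R := by linarith
  set A : ℝ := c * R ^ (-(n / q₀ + ε)) with hA
  have hApos : 0 < A := by positivity
  have hrate : A ^ p / R ^ 2 * t ≤ 1 := by
    have htR : t = R ^ (2 + n * p / q₀) := by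
      rw [hR, ← Real.rpow_mul ht0.le, ha, one_div_mul_cancel (by positivity), Real.rpow_one]
    have h1 : A ^ p ≤ (R ^ (-(n / q₀))) ^ p := by
      refine Real.rpow_le_rpow hApos.le ?_ hp0.le
      calc A ≤ 1 * R ^ (-(n / q₀ + ε)) := by rw [hA]; gcongr
        _ ≤ R ^ (-(n / q₀)) := by
          rw [one_mul]
          exact Real.rpow_le_rpow_of_exponent_le hR1 (by linarith)
    calc A ^ p / R ^ 2 * t ≤ (R ^ (-(n / q₀))) ^ p / R ^ 2 * t := by gcongr
      _ = 1 := by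
        nth_rewrite 1 [htR]
        rw [← Real.rpow_mul hRpos.le, ← Real.rpow_natCast R 2, ← Real.rpow_sub hRpos,
          ← Real.rpow_add hRpos]
        convert Real.rpow_zero R using 2
        push_cast
        field_simp
        ring
  have hball : ∀ x : Euc n, ‖x‖ < R / 2 →
      A * Real.exp (-(2 * n + 1)) * (3 / 4) ≤ u x t := by
    intro x hx
    refine le_trans ?_ (hu.exp_mul_le hp hpos hApos hRpos (hlow R hR1)
      (by linarith : ‖x‖ ≤ R) ht0.le).le
    have h1 : ‖x‖ ^ 2 / R ^ 2 ≤ 1 / 4 := by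
      rw [div_le_iff₀ (by positivity)]
      nlinarith [norm_nonneg x]
    have h2 : (2 * n + 1) * A ^ p / R ^ 2 * t ≤ 2 * n + 1 := by
      have : (2 * n + 1) * A ^ p / R ^ 2 * t = (2 * n + 1) * (A ^ p / R ^ 2 * t) := by ring
      rw [this]
      exact mul_le_of_le_one_right (by positivity) hrate
    gcongr
    linarith
  refine le_trans (le_of_eq ?_) (eLpNorm_ge_of_ball hq0 (by positivity) (half_pos hRpos) hball)
  congr 1
  have hexp : t ^ (-((1 - q₀ / q.toReal) / (p + 2 * q₀ / n)) - δ) =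
      R ^ (-(n / q₀ + ε)) * (R ^ n) ^ r := by
    rw [← Real.rpow_natCast R n, ← Real.rpow_mul hRpos.le, ← Real.rpow_add hRpos, hR,
      ← Real.rpow_mul ht0.le]
    congr 1
    have h1 : a * ε = δ := by rw [hε]; field_simp
    have h2 : 1 / (p + 2 * q₀ / n) = a * (n / q₀) := by rw [ha]; field_simp; ring
    have h3 : q₀ / q.toReal = q₀ * r := by rw [hr]; ring
    rw [div_eq_mul_one_div, h2, h3, ← h1]
    field_simp
    ring
  rw [hexp, ← hV, ← hr, show (R / 2) ^ n * V = R ^ n * ((1 / 2) ^ n * V) by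
    rw [div_pow, div_pow, one_pow]; ring, Real.mul_rpow (x := R ^ n) (by positivity) (by positivity), hA]
  ring
end
end

section
/- Let n ≥ 1 be an integer, p > 1, α ∈ (0, 1/p), A > 0, and set β := (1 − pα)/2 > 0. Then there exists a function f : [0,∞) → (0,∞) with f ∈ C¹([0,∞)) ∩ C²((0,∞)), f(0) = A, f'(0) = 0, satisfying f(ξ)^p (f''(ξ) + (n−1)ξ^{−1} f'(ξ)) + β ξ f'(ξ) + α f(ξ) = 0 for all ξ > 0, together with constants c > 0 and C > 0 such that c(1+ξ)^{−α/β} ≤ f(ξ) ≤ C(1+ξ)^{−α/β} for all ξ ≥ 0, and such that the function u(x,t) := t^{−α} f(t^{−β}|x|), defined for x ∈ ℝⁿ and t > 0, is a positive classical solution of ∂_t u = u^p Δu in ℝⁿ × (0,∞). -/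
open MeasureTheory
open scoped ENNReal
noncomputable section

/-- The weighted average `∫₀¹ τᵐ h(τ²σ) dτ`. -/
def radialMean (m : ℕ) (h : ℝ → ℝ) (σ : ℝ) : ℝ :=
  ∫ τ in (0 : ℝ)..1, τ ^ m * h (τ ^ 2 * σ)

theorem continuous_radialMean (m : ℕ) {h : ℝ → ℝ} (hh : Continuous h) :
    Continuous (radialMean m h) := by
  unfold radialMean
  apply intervalIntegral.continuous_parametric_intervalIntegral_of_continuous'
  simp only [Function.uncurry_def]
  fun_prop

theorem intervalIntegrable_radialMean (m : ℕ) {h : ℝ → ℝ} (hh : Continuous h) (σ : ℝ) :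
    IntervalIntegrable (fun τ : ℝ => τ ^ m * h (τ ^ 2 * σ)) volume 0 1 :=
  Continuous.intervalIntegrable (by fun_prop) _ _

theorem radialMean_sub (m : ℕ) {h₁ h₂ : ℝ → ℝ} (hh₁ : Continuous h₁) (hh₂ : Continuous h₂)
    (σ : ℝ) : radialMean m (fun s => h₁ s - h₂ s) σ = radialMean m h₁ σ - radialMean m h₂ σ := by
  unfold radialMean
  rw [← intervalIntegral.integral_sub (intervalIntegrable_radialMean m hh₁ σ)
    (intervalIntegrable_radialMean m hh₂ σ)]
  simp only [mul_sub]

theorem radialMean_const (m : ℕ) (B σ : ℝ) : radialMean m (fun _ => B) σ = B / (m + 1) := by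
  simp [radialMean]
  ring

theorem radialMean_mono (m : ℕ) {h₁ h₂ : ℝ → ℝ} (hh₁ : Continuous h₁) (hh₂ : Continuous h₂)
    {σ : ℝ} (hle : ∀ τ ∈ Set.Icc (0 : ℝ) 1, h₁ (τ ^ 2 * σ) ≤ h₂ (τ ^ 2 * σ)) :
    radialMean m h₁ σ ≤ radialMean m h₂ σ := by
  apply intervalIntegral.integral_mono_on zero_le_one (intervalIntegrable_radialMean m hh₁ σ)
    (intervalIntegrable_radialMean m hh₂ σ)
  intro τ hτ
  exact mul_le_mul_of_nonneg_left (hle τ hτ) (pow_nonneg hτ.1 m)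

theorem abs_radialMean_le (m : ℕ) {h : ℝ → ℝ} (hh : Continuous h) {σ B : ℝ}
    (hle : ∀ s, |s| ≤ |σ| → |h s| ≤ B) : |radialMean m h σ| ≤ B := by
  have hB : 0 ≤ B := (abs_nonneg _).trans (hle σ le_rfl)
  have key : ∀ τ ∈ Set.Icc (0 : ℝ) 1, |h (τ ^ 2 * σ)| ≤ B := by
    intro τ hτ
    apply hle
    rw [abs_mul, abs_of_nonneg (sq_nonneg τ)]
    exact mul_le_of_le_one_left (abs_nonneg _) (pow_le_one₀ hτ.1 hτ.2)
  have h1 := radialMean_mono m (σ := σ) hh (continuous_const (y := B))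
    fun τ hτ => (abs_le.1 (key τ hτ)).2
  have h2 := radialMean_mono m (σ := σ) (continuous_const (y := -B)) hh
    fun τ hτ => (abs_le.1 (key τ hτ)).1
  rw [radialMean_const] at h1 h2
  have h3 : B / (m + 1) ≤ B := div_le_self hB (by linarith [m.cast_nonneg (α := ℝ)])
  rw [neg_div] at h2
  exact abs_le.2 ⟨by linarith, by linarith⟩

theorem hasDerivAt_radialMean (m : ℕ) {h h' : ℝ → ℝ} (hd : ∀ s, HasDerivAt h (h' s) s)
    (hh' : Continuous h') (σ : ℝ) :
    HasDerivAt (radialMean m h) (radialMean (m + 2) h' σ) σ := by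
  have hh : Continuous h := continuous_iff_continuousAt.2 fun s => (hd s).continuousAt
  obtain ⟨B, hB⟩ := (isCompact_Icc (a := -(|σ| + 1)) (b := |σ| + 1)).exists_bound_of_continuousOn
    hh'.continuousOn
  have hF : ∀ τ x : ℝ, HasDerivAt (fun x => τ ^ m * h (τ ^ 2 * x))
      (τ ^ (m + 2) * h' (τ ^ 2 * x)) x := by
    intro τ x
    have h2 : HasDerivAt (fun x : ℝ => τ ^ 2 * x) (τ ^ 2) x := by
      simpa using (hasDerivAt_id x).const_mul (τ ^ 2)
    exact (((hd (τ ^ 2 * x)).comp x h2).const_mul (τ ^ m)).congr_deriv (by ring)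
  refine (intervalIntegral.hasDerivAt_integral_of_dominated_loc_of_deriv_le
    (F := fun x τ => τ ^ m * h (τ ^ 2 * x)) (F' := fun x τ => τ ^ (m + 2) * h' (τ ^ 2 * x))
    (bound := fun _ => B) (Metric.ball_mem_nhds σ one_pos) ?_ ?_ ?_ ?_ ?_ ?_).2
  · exact Filter.Eventually.of_forall fun x =>
      Continuous.aestronglyMeasurable (by fun_prop)
  · exact intervalIntegrable_radialMean m hh σ
  · exact Continuous.aestronglyMeasurable (by fun_prop)
  · refine Filter.Eventually.of_forall fun τ hτ x hx => ?_
    rw [Set.uIoc_of_le zero_le_one] at hτ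
    have hx' : |x| ≤ |σ| + 1 := by
      have := abs_sub_abs_le_abs_sub x σ
      rw [Metric.mem_ball, Real.dist_eq] at hx
      linarith
    have hmem : |τ ^ 2 * x| ≤ |σ| + 1 := by
      rw [abs_mul, abs_of_nonneg (sq_nonneg τ)]
      exact (mul_le_of_le_one_left (abs_nonneg _) (pow_le_one₀ hτ.1.le hτ.2)).trans hx'
    have := hB _ (abs_le.1 hmem)
    rw [norm_mul, norm_pow, Real.norm_of_nonneg hτ.1.le]
    exact (mul_le_of_le_one_left (norm_nonneg _) (pow_le_one₀ hτ.1.le hτ.2)).trans this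
  · exact intervalIntegrable_const
  · exact Filter.Eventually.of_forall fun τ _ x _ => hF τ x

theorem two_mul_radialMean_deriv (m : ℕ) {h h' : ℝ → ℝ} (hd : ∀ s, HasDerivAt h (h' s) s)
    (hh' : Continuous h') (σ : ℝ) :
    2 * σ * radialMean (m + 2) h' σ = h σ - (m + 1) * radialMean m h σ := by
  have hh : Continuous h := continuous_iff_continuousAt.2 fun s => (hd s).continuousAt
  have hF : ∀ τ ∈ Set.uIcc (0 : ℝ) 1, HasDerivAt (fun τ : ℝ => τ ^ (m + 1) * h (τ ^ 2 * σ))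
      ((m + 1) * (τ ^ m * h (τ ^ 2 * σ)) + 2 * σ * (τ ^ (m + 2) * h' (τ ^ 2 * σ))) τ := by
    intro τ _
    have h1 : HasDerivAt (fun τ : ℝ => τ ^ 2 * σ) (2 * τ * σ) τ := by
      simpa using (hasDerivAt_pow 2 τ).mul_const σ
    refine ((hasDerivAt_pow (m + 1) τ).mul ((hd (τ ^ 2 * σ)).comp τ h1)).congr_deriv ?_
    simp only [Function.comp, Nat.add_sub_cancel]
    push_cast
    ring
  have := intervalIntegral.integral_eq_sub_of_hasDerivAt hF
    (Continuous.intervalIntegrable (by fun_prop) _ _)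
  rw [intervalIntegral.integral_add (Continuous.intervalIntegrable (by fun_prop) _ _)
    (Continuous.intervalIntegrable (by fun_prop) _ _), intervalIntegral.integral_const_mul,
    intervalIntegral.integral_const_mul] at this
  simp only [one_pow, one_mul, ne_eq, Nat.add_eq_zero_iff, one_ne_zero, and_false,
    not_false_eq_true, zero_pow, zero_mul, sub_zero] at this
  unfold radialMean
  linarith

theorem abs_integral_le_of_abs_le {g W : ℝ → ℝ} (hg : Continuous g) (hW : Continuous W)
    (h : ∀ s, |g s| ≤ W |s|) (σ : ℝ) : |∫ s in (0 : ℝ)..σ, g s| ≤ ∫ s in (0 : ℝ)..|σ|, W s := by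
  have aux : ∀ g : ℝ → ℝ, Continuous g → (∀ s, |g s| ≤ W |s|) → ∀ r, 0 ≤ r →
      |∫ s in (0 : ℝ)..r, g s| ≤ ∫ s in (0 : ℝ)..r, W s := by
    intro g hg h r hr
    refine (intervalIntegral.abs_integral_le_integral_abs hr).trans
      (intervalIntegral.integral_mono_on hr (hg.abs.intervalIntegrable _ _)
        (hW.intervalIntegrable _ _) fun s hs => ?_)
    simpa [abs_of_nonneg hs.1] using h s
  rcases le_total 0 σ with hσ | hσ
  · rw [abs_of_nonneg hσ]
    exact aux g hg h σ hσ
  · have h1 := aux (fun s => g (-s)) (by fun_prop) (fun s => by simpa using h (-s)) (-σ)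
      (by linarith)
    rw [intervalIntegral.integral_comp_neg, neg_neg, neg_zero, intervalIntegral.integral_symm,
      abs_neg] at h1
    rwa [abs_of_nonpos hσ]

/-- A nonlinear Volterra equation driven by a linear causal operator `K` has a global solution. -/
theorem exists_volterra_solution (K : (ℝ → ℝ) → ℝ → ℝ) (C : ℝ) (hC : 0 < C)
    (hKc : ∀ h, Continuous h → Continuous (K h))
    (hKs : ∀ h₁ h₂, Continuous h₁ → Continuous h₂ →
      ∀ s, K (fun s => h₁ s - h₂ s) s = K h₁ s - K h₂ s)
    (hKb : ∀ h, Continuous h → ∀ σ B, (∀ s, |s| ≤ |σ| → |h s| ≤ B) → |K h σ| ≤ C * B)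
    (φ : ℝ → ℝ → ℝ) (hφ : Continuous fun q : ℝ × ℝ => φ q.1 q.2)
    (N : ℝ → ℝ) (hN : Continuous N) (hN0 : ∀ s, 0 ≤ N s) (hNm : MonotoneOn N (Set.Ici 0))
    (A : ℝ) (hφA : ∀ s, |φ s A| ≤ N |s|)
    (hφL : ∀ s y y', |φ s y - φ s y'| ≤ N |s| * |y - y'|) :
    ∃ ψ : ℝ → ℝ, Continuous ψ ∧
      ∀ σ, ψ σ = A + ∫ s in (0 : ℝ)..σ, K (fun s => φ s (ψ s)) s := by
  set Λ : ℝ → ℝ := fun r => ∫ s in (0 : ℝ)..r, 2 * C * N s with hΛ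
  have hΛd : ∀ r, HasDerivAt Λ (2 * C * N r) r := fun r =>
    (show Continuous fun s => 2 * C * N s by fun_prop).integral_hasStrictDerivAt 0 r |>.hasDerivAt
  have hΛc : Continuous Λ := continuous_iff_continuousAt.2 fun r => (hΛd r).continuousAt
  have hΛ0 : Λ 0 = 0 := by simp [hΛ]
  have hΛm : Monotone Λ := monotone_of_deriv_nonneg (fun r => (hΛd r).differentiableAt)
    fun r => by rw [(hΛd r).deriv]; have := hN0 r; positivity
  have hint : ∀ B r, ∫ s in (0 : ℝ)..r, C * (B * N s * Real.exp (Λ s)) =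
      B / 2 * (Real.exp (Λ r) - 1) := by
    intro B r
    have := intervalIntegral.integral_eq_sub_of_hasDerivAt (a := 0) (b := r)
      (f := fun s => B / 2 * Real.exp (Λ s)) (f' := fun s => C * (B * N s * Real.exp (Λ s)))
      (fun s _ => by
        exact ((hΛd s).exp.const_mul (B / 2)).congr_deriv (by ring))
      (Continuous.intervalIntegrable (by fun_prop) _ _)
    rw [this, hΛ0]
    simp
    ring
  have hmono : ∀ B, 0 ≤ B → ∀ s σ : ℝ, |s| ≤ |σ| →
      B * N |s| * Real.exp (Λ |s|) ≤ B * N |σ| * Real.exp (Λ |σ|) := by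
    intro B hB s σ hs
    have h1 := hNm (abs_nonneg s) (abs_nonneg σ) hs
    have h2 := hΛm hs
    have h3 := hN0 |s|
    have h4 := hN0 |σ|
    gcongr
  have hV : ∀ h, Continuous h → ∀ B, 0 ≤ B → (∀ s, |h s| ≤ B * N |s| * Real.exp (Λ |s|)) →
      ∀ σ, |∫ s in (0 : ℝ)..σ, K h s| ≤ B / 2 * Real.exp (Λ |σ|) := by
    intro h hh B hB hle σ
    have h1 := abs_integral_le_of_abs_le (hKc h hh)
      (W := fun s => C * (B * N s * Real.exp (Λ s))) (by fun_prop)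
      (fun s => hKb h hh s _ fun s' hs' => (hle s').trans (hmono B hB s' s hs')) σ
    rw [hint] at h1
    refine h1.trans ?_
    gcongr
    linarith
  have hφc : ∀ z : BoundedContinuousFunction ℝ ℝ,
      Continuous fun s => φ s (A + Real.exp (Λ |s|) * z s) := fun z =>
    hφ.comp (continuous_id.prodMk (by fun_prop))
  have hTc : ∀ z : BoundedContinuousFunction ℝ ℝ, Continuous fun σ => Real.exp (-Λ |σ|) *
      ∫ s in (0 : ℝ)..σ, K (fun s => φ s (A + Real.exp (Λ |s|) * z s)) s := by
    intro z
    have h1 : Continuous fun σ =>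
        ∫ s in (0 : ℝ)..σ, K (fun s => φ s (A + Real.exp (Λ |s|) * z s)) s :=
      intervalIntegral.continuous_primitive
        (fun a b => (hKc _ (hφc z)).intervalIntegrable a b) 0
    fun_prop
  have hTb : ∀ z : BoundedContinuousFunction ℝ ℝ, ∀ σ, ‖Real.exp (-Λ |σ|) *
      ∫ s in (0 : ℝ)..σ, K (fun s => φ s (A + Real.exp (Λ |s|) * z s)) s‖ ≤ (1 + ‖z‖) / 2 := by
    intro z σ
    have h1 := hV _ (hφc z) (1 + ‖z‖) (by positivity) (fun s => by
      have e1 := hφL s (A + Real.exp (Λ |s|) * z s) A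
      have e2 := hφA s
      have e3 := abs_sub_abs_le_abs_sub (φ s (A + Real.exp (Λ |s|) * z s)) (φ s A)
      have e4 : |z s| ≤ ‖z‖ := z.norm_coe_le_norm s
      have e5 : 1 ≤ Real.exp (Λ |s|) :=
        Real.one_le_exp (hΛ0 ▸ hΛm (abs_nonneg s))
      have e6 := hN0 |s|
      rw [add_sub_cancel_left, abs_mul, Real.abs_exp] at e1
      have e7 : N |s| * (Real.exp (Λ |s|) * |z s|) ≤ N |s| * (Real.exp (Λ |s|) * ‖z‖) := by
        gcongr
      have e8 : N |s| * 1 ≤ N |s| * Real.exp (Λ |s|) := by gcongr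
      linarith) σ
    rw [norm_mul, Real.norm_eq_abs, Real.abs_exp, Real.norm_eq_abs]
    calc _ ≤ Real.exp (-Λ |σ|) * ((1 + ‖z‖) / 2 * Real.exp (Λ |σ|)) := by gcongr
      _ = (1 + ‖z‖) / 2 * (Real.exp (-Λ |σ|) * Real.exp (Λ |σ|)) := by ring
      _ = (1 + ‖z‖) / 2 := by rw [← Real.exp_add]; simp
  set T : BoundedContinuousFunction ℝ ℝ → BoundedContinuousFunction ℝ ℝ := fun z =>
    BoundedContinuousFunction.ofNormedAddCommGroup _ (hTc z) _ (hTb z) with hT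
  have hTcontr : ContractingWith (1 / 2) T := by
    refine ⟨by norm_num, LipschitzWith.of_dist_le_mul fun z w => ?_⟩
    rw [BoundedContinuousFunction.dist_le (by positivity)]
    intro σ
    have h1 := hV _ ((hφc z).sub (hφc w)) (dist z w) dist_nonneg (fun s => by
      refine (hφL s _ _).trans ?_
      have e4 : |z s - w s| ≤ dist z w := z.dist_coe_le_dist s
      have e6 := hN0 |s|
      rw [add_sub_add_left_eq_sub, ← mul_sub, abs_mul, Real.abs_exp]
      calc _ ≤ N |s| * (Real.exp (Λ |s|) * dist z w) := by gcongr
        _ = _ := by ring) σ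
    have h2 : (T z) σ - (T w) σ = Real.exp (-Λ |σ|) * ∫ s in (0 : ℝ)..σ,
        K (fun s => φ s (A + Real.exp (Λ |s|) * z s) - φ s (A + Real.exp (Λ |s|) * w s)) s := by
      simp only [hT, BoundedContinuousFunction.coe_ofNormedAddCommGroup]
      rw [← mul_sub, ← intervalIntegral.integral_sub ((hKc _ (hφc z)).intervalIntegrable _ _)
        ((hKc _ (hφc w)).intervalIntegrable _ _)]
      congr 2
      ext s
      rw [hKs _ _ (hφc z) (hφc w)]
    rw [Real.dist_eq, h2, abs_mul, Real.abs_exp]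
    calc _ ≤ Real.exp (-Λ |σ|) * (dist z w / 2 * Real.exp (Λ |σ|)) := by gcongr; exact h1
      _ = dist z w / 2 * (Real.exp (-Λ |σ|) * Real.exp (Λ |σ|)) := by ring
      _ = dist z w / 2 := by rw [← Real.exp_add]; simp
      _ = _ := by push_cast; ring
  have hfix := hTcontr.fixedPoint_isFixedPt
  set z := ContractingWith.fixedPoint T hTcontr
  refine ⟨fun s => A + Real.exp (Λ |s|) * z s, by fun_prop, fun σ => ?_⟩
  have hz : z σ = Real.exp (-Λ |σ|) *
      ∫ s in (0 : ℝ)..σ, K (fun s => φ s (A + Real.exp (Λ |s|) * z s)) s := by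
    conv_lhs => rw [← hfix.eq]
    rfl
  show A + Real.exp (Λ |σ|) * z σ = _
  rw [hz, ← mul_assoc, ← Real.exp_add]
  simp

/-- A `C¹` extension of `z ↦ z ^ (1 - p)` from `[1, ∞)` to `ℝ`, with bounded derivative. -/
def truncPow (p z : ℝ) : ℝ := 1 + ∫ s in (1 : ℝ)..z, (1 - p) * max s 1 ^ (-p)

theorem continuous_truncPow_deriv (p : ℝ) :
    Continuous fun s : ℝ => (1 - p) * max s 1 ^ (-p) := by
  refine continuous_const.mul ((continuous_id.max continuous_const).rpow_const fun s => Or.inl ?_)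
  exact (lt_of_lt_of_le one_pos (le_max_right s 1)).ne'

theorem hasDerivAt_truncPow (p z : ℝ) :
    HasDerivAt (truncPow p) ((1 - p) * max z 1 ^ (-p)) z :=
  (((continuous_truncPow_deriv p).integral_hasStrictDerivAt 1 z).hasDerivAt).const_add 1

theorem contDiff_truncPow (p : ℝ) : ContDiff ℝ 1 (truncPow p) := by
  rw [contDiff_one_iff_deriv]
  refine ⟨fun z => (hasDerivAt_truncPow p z).differentiableAt, ?_⟩
  rw [show deriv (truncPow p) = _ from funext fun z => (hasDerivAt_truncPow p z).deriv]
  exact continuous_truncPow_deriv p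

theorem truncPow_eq {p z : ℝ} (hz : 1 ≤ z) : truncPow p z = z ^ (1 - p) := by
  have h := intervalIntegral.integral_eq_sub_of_hasDerivAt (a := 1) (b := z)
    (f := fun s => s ^ (1 - p)) (f' := fun s => (1 - p) * max s 1 ^ (-p))
    (fun s hs => by
      rw [Set.uIcc_of_le hz] at hs
      have := Real.hasDerivAt_rpow_const (x := s) (p := 1 - p) (Or.inl (by linarith [hs.1]))
      refine this.congr_deriv ?_
      rw [max_eq_left hs.1]
      ring_nf)
    ((continuous_truncPow_deriv p).intervalIntegrable _ _)
  rw [truncPow, h, Real.one_rpow]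
  ring

theorem abs_truncPow_sub_le {p : ℝ} (hp : 1 < p) (y z : ℝ) :
    |truncPow p y - truncPow p z| ≤ (p - 1) * |y - z| := by
  refine Convex.norm_image_sub_le_of_norm_hasDerivWithin_le (s := Set.univ)
    (fun x _ => (hasDerivAt_truncPow p x).hasDerivWithinAt) (fun x _ => ?_) convex_univ
    (Set.mem_univ z) (Set.mem_univ y)
  have h1 : max x 1 ^ (-p) ≤ 1 :=
    Real.rpow_le_one_of_one_le_of_nonpos (le_max_right x 1) (by linarith)
  have h2 : 0 ≤ max x 1 ^ (-p) := by positivity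
  rw [norm_mul, Real.norm_of_nonneg h2, Real.norm_eq_abs, abs_of_neg (by linarith)]
  nlinarith

/-- The function `ψ` solves `deriv ψ = k` with `k = (b h - c ∫₀¹ τᵐ h(τ² ·) dτ) / 2` and `dh = deriv h`. -/
structure IsVolterraProfile (m : ℕ) (b c A : ℝ) (ψ k h dh : ℝ → ℝ) : Prop where
  zero : ψ 0 = A
  deriv_ψ : ∀ s, HasDerivAt ψ (k s) s
  deriv_h : ∀ s, HasDerivAt h (dh s) s
  cont_dh : Continuous dh
  k_eq : ∀ s, k s = (b * h s - c * radialMean m h s) / 2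

theorem exists_truncated_profile (m : ℕ) {b c p A C γ : ℝ} (hb : 0 < b) (hc : 0 < c) (hp : 1 < p)
    (hA : 0 < A) (hC : 0 < C) (hγ : 0 < γ) :
    ∃ ψ k h dh : ℝ → ℝ, IsVolterraProfile m b c A ψ k h dh ∧
      ∀ s, 1 ≤ (C * (2 + 2 * s ^ 2) ^ γ) ^ (p - 1)⁻¹ * ψ s → h s = ψ s ^ (1 - p) := by
  have hq : 0 < p - 1 := by linarith
  set W : ℝ → ℝ := fun s => C * (2 + 2 * s ^ 2) ^ γ with hW
  set E : ℝ → ℝ := fun s => W s ^ (p - 1)⁻¹ with hE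
  have hpos : ∀ s : ℝ, 0 < 2 + 2 * s ^ 2 := fun s => by positivity
  have hWpos : ∀ s, 0 < W s := fun s => mul_pos hC (Real.rpow_pos_of_pos (hpos s) _)
  have hEpos : ∀ s, 0 < E s := fun s => Real.rpow_pos_of_pos (hWpos s) _
  have hWd : ContDiff ℝ 1 W := contDiff_const.mul
    (ContDiff.rpow_const_of_ne (by fun_prop) fun s => (hpos s).ne')
  have hEd : ContDiff ℝ 1 E := ContDiff.rpow_const_of_ne hWd fun s => (hWpos s).ne'
  have hWa : ∀ s, W |s| = W s := fun s => by simp [hW]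
  have hEa : ∀ s, E |s| = E s := fun s => by simp only [hE, hWa]
  have hWm : MonotoneOn W (Set.Ici 0) := by
    intro s hs t ht hst
    have hs : 0 ≤ s := hs
    simp only [hW]
    gcongr
  have hEm : MonotoneOn E (Set.Ici 0) := fun s hs t ht hst =>
    Real.rpow_le_rpow (hWpos s).le (hWm hs ht hst) (inv_nonneg.2 hq.le)
  have hEW : ∀ s, E s ^ (1 - p) = (W s)⁻¹ := by
    intro s
    rw [hE, ← Real.rpow_mul (hWpos s).le, show (p - 1)⁻¹ * (1 - p) = -1 by field_simp; ring,
      Real.rpow_neg_one]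
  have hWc := hWd.continuous
  have hEc := hEd.continuous
  have hΦc := (contDiff_truncPow p).continuous
  obtain ⟨ψ, hψc, hψ⟩ := exists_volterra_solution
    (fun h s => (b * h s - c * radialMean m h s) / 2) (b + c) (by linarith)
    (fun h hh => by
      have := continuous_radialMean m hh
      fun_prop)
    (fun h₁ h₂ hh₁ hh₂ s => by
      simp only [radialMean_sub m hh₁ hh₂]
      ring)
    (fun h hh σ B hB => by
      have h1 := abs_radialMean_le m hh hB
      have h2 := hB σ le_rfl
      have hB0 := (abs_nonneg _).trans h2
      have h3 := abs_sub (b * h σ) (c * radialMean m h σ)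
      rw [abs_mul, abs_mul, abs_of_pos hb, abs_of_pos hc] at h3
      rw [abs_div, abs_two]
      have h4 : b * |h σ| ≤ b * B := by gcongr
      have h5 : c * |radialMean m h σ| ≤ c * B := by gcongr
      have h6 : 0 ≤ b * B := by positivity
      have h7 : 0 ≤ c * B := by positivity
      linarith)
    (fun s y => W s * truncPow p (E s * y)) (by fun_prop)
    (fun r => W r * (1 + (p - 1) * (E r * (A + 1) + 1))) (by fun_prop)
    (fun r => by have := hWpos r; have := hEpos r; positivity)
    (fun s hs t ht hst => by
      have h1 := hWm hs ht hst
      have h2 := hEm hs ht hst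
      have h3 := hWpos s
      have h4 := hEpos s
      have h5 := hWpos t
      dsimp only
      gcongr)
    A
    (fun s => by
      have h1 := abs_truncPow_sub_le hp (E s * A) 1
      have h2 := abs_sub_abs_le_abs_sub (truncPow p (E s * A)) (truncPow p 1)
      have h3 := abs_sub (E s * A) 1
      have h4 := hEpos s
      rw [truncPow_eq le_rfl, Real.one_rpow, abs_one] at h2
      rw [abs_of_pos (by positivity : 0 < E s * A), abs_one] at h3
      rw [truncPow_eq le_rfl, Real.one_rpow] at h1
      rw [hWa, hEa, abs_mul, abs_of_pos (hWpos s)]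
      refine mul_le_mul_of_nonneg_left ?_ (hWpos s).le
      have h5 : (p - 1) * |E s * A - 1| ≤ (p - 1) * (E s * (A + 1) + 1) := by
        gcongr
        linarith
      linarith)
    (fun s y y' => by
      have h1 := abs_truncPow_sub_le hp (E s * y) (E s * y')
      rw [← mul_sub, abs_mul, abs_of_pos (hEpos s)] at h1
      have h4 := hEpos s
      rw [hWa, hEa, ← mul_sub, abs_mul, abs_of_pos (hWpos s), mul_assoc (W s)]
      refine mul_le_mul_of_nonneg_left (h1.trans ?_) (hWpos s).le
      rw [← mul_assoc]
      refine mul_le_mul_of_nonneg_right ?_ (abs_nonneg _)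
      have : (p - 1) * E s ≤ (p - 1) * (E s * (A + 1) + 1) := by
        gcongr
        nlinarith
      linarith)
  set h : ℝ → ℝ := fun s => W s * truncPow p (E s * ψ s) with hh
  have hhc : Continuous h := by fun_prop
  have hMc := continuous_radialMean m hhc
  have hkc : Continuous fun s => (b * h s - c * radialMean m h s) / 2 := by fun_prop
  have hψd : ∀ s, HasDerivAt ψ ((b * h s - c * radialMean m h s) / 2) s := by
    intro s
    rw [show ψ = fun σ => A + ∫ s in (0 : ℝ)..σ, (b * h s - c * radialMean m h s) / 2 from
      funext hψ]
    exact ((hkc.integral_hasStrictDerivAt 0 s).hasDerivAt).const_add A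
  have hψd1 : ContDiff ℝ 1 ψ := by
    rw [contDiff_one_iff_deriv]
    refine ⟨fun z => (hψd z).differentiableAt, ?_⟩
    rwa [show deriv ψ = _ from funext fun z => (hψd z).deriv]
  have hhd : ContDiff ℝ 1 h := hWd.mul ((contDiff_truncPow p).comp (hEd.mul hψd1))
  rw [contDiff_one_iff_deriv] at hhd
  refine ⟨ψ, _, h, deriv h, ⟨by rw [hψ 0]; simp, hψd, fun s => (hhd.1 s).hasDerivAt, hhd.2,
    fun s => rfl⟩, fun s hs => ?_⟩
  have hψpos : 0 < ψ s := by
    by_contra hcon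
    have := mul_nonpos_of_nonneg_of_nonpos (hEpos s).le (not_lt.1 hcon)
    have hs' : 1 ≤ E s * ψ s := hs
    linarith
  show W s * truncPow p (E s * ψ s) = _
  rw [truncPow_eq hs, Real.mul_rpow (hEpos s).le hψpos.le, hEW, ← mul_assoc,
    mul_inv_cancel₀ (hWpos s).ne', one_mul]

/-- On `[0, R)` the profile is positive and `h` is the power `ψ ^ (1 - p)`. -/
def IsPowerOn (p R : ℝ) (ψ k h dh : ℝ → ℝ) : Prop :=
  ∀ s, 0 ≤ s → s < R → 0 < ψ s ∧ h s = ψ s ^ (1 - p) ∧ dh s = (1 - p) * ψ s ^ (-p) * k s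

namespace IsVolterraProfile

variable {m : ℕ} {b α p A R : ℝ} {ψ k h dh : ℝ → ℝ}

theorem cont_h {c : ℝ} (H : IsVolterraProfile m b c A ψ k h dh) : Continuous h :=
  continuous_iff_continuousAt.2 fun s => (H.deriv_h s).continuousAt

theorem cont_ψ {c : ℝ} (H : IsVolterraProfile m b c A ψ k h dh) : Continuous ψ :=
  continuous_iff_continuousAt.2 fun s => (H.deriv_ψ s).continuousAt

theorem deriv_k {c : ℝ} (H : IsVolterraProfile m b c A ψ k h dh) (s : ℝ) :
    HasDerivAt k ((b * dh s - c * radialMean (m + 2) dh s) / 2) s := by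
  rw [show k = fun s => (b * h s - c * radialMean m h s) / 2 from funext H.k_eq]
  exact (((H.deriv_h s).const_mul b).sub
    ((hasDerivAt_radialMean m H.deriv_h H.cont_dh s).const_mul c)).div_const 2

theorem k_nonpos (H : IsVolterraProfile m b ((m + 1) * b + α) A ψ k h dh)
    (hP : IsPowerOn p R ψ k h dh) (hb : 0 < b) (hα : 0 < α) {s : ℝ} (hs0 : 0 ≤ s) (hsR : s < R) :
    k s ≤ 0 := by
  have hm : (0 : ℝ) < m + 1 := by positivity
  have hpos : ∀ t, 0 ≤ t → t < R → 0 < h t := fun t ht htR => by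
    rw [(hP t ht htR).2.1]
    exact Real.rpow_pos_of_pos (hP t ht htR).1 _
  have hk0 : k 0 = -(α / (2 * (m + 1))) * h 0 := by
    have h1 := two_mul_radialMean_deriv m H.deriv_h H.cont_dh 0
    have h2 := H.k_eq 0
    have h3 : radialMean m h 0 = h 0 / (m + 1) := by
      field_simp
      linarith
    rw [h2, h3]
    field_simp
    ring
  have hk0neg : k 0 < 0 := by
    rw [hk0]
    have := hpos 0 le_rfl (hs0.trans_lt hsR)
    have h3 : 0 < α / (2 * (m + 1)) := by positivity
    nlinarith
  refine image_le_of_deriv_right_lt_deriv_boundary' (a := 0) (b := s) (f := k)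
    (B := fun _ => 0) (B' := fun _ => 0)
    (fun t _ => (H.deriv_k t).continuousAt.continuousWithinAt)
    (fun t _ => (H.deriv_k t).hasDerivWithinAt) hk0neg.le continuousOn_const
    (fun t _ => hasDerivWithinAt_const _ _ _) ?_ ⟨hs0, le_rfl⟩
  intro t ht hkt
  have ht0 : 0 < t := by
    rcases ht.1.eq_or_lt with h0 | h0
    · rw [← h0] at hkt
      linarith
    · exact h0
  have htR := ht.2.trans hsR
  have h1 := two_mul_radialMean_deriv m H.deriv_h H.cont_dh t
  have h2 := H.k_eq t
  have h4 := hpos t ht.1 htR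
  rw [(hP t ht.1 htR).2.2, hkt]
  rw [hkt] at h2
  have hbα : 0 < (m + 1) * b + α := by positivity
  have h5 : 0 < radialMean m h t := by
    have : 0 < ((m + 1) * b + α) * radialMean m h t := by nlinarith
    exact pos_of_mul_pos_right this hbα.le
  have h6 : 0 < b * (2 * t * radialMean (m + 2) dh t) := by
    rw [h1]
    nlinarith [mul_pos hα h5]
  have h7 : 0 < radialMean (m + 2) dh t := by
    have : 0 < (b * (2 * t)) * radialMean (m + 2) dh t := by linarith
    exact pos_of_mul_pos_right this (by positivity)
  nlinarith [mul_pos hbα h7]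

theorem antitoneOn (H : IsVolterraProfile m b ((m + 1) * b + α) A ψ k h dh)
    (hP : IsPowerOn p R ψ k h dh) (hb : 0 < b) (hα : 0 < α) :
    AntitoneOn ψ (Set.Ico 0 R) := by
  refine antitoneOn_of_deriv_nonpos (convex_Ico 0 R) H.cont_ψ.continuousOn
    (fun s _ => (H.deriv_ψ s).differentiableAt.differentiableWithinAt) fun s hs => ?_
  rw [interior_Ico] at hs
  rw [(H.deriv_ψ s).deriv]
  exact H.k_nonpos hP hb hα hs.1.le hs.2

theorem h_monotoneOn (H : IsVolterraProfile m b ((m + 1) * b + α) A ψ k h dh)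
    (hP : IsPowerOn p R ψ k h dh) (hb : 0 < b) (hα : 0 < α) (hp : 1 < p) :
    MonotoneOn h (Set.Ico 0 R) := by
  intro s hs t ht hst
  rw [(hP s hs.1 hs.2).2.1, (hP t ht.1 ht.2).2.1]
  exact Real.rpow_le_rpow_of_nonpos (hP t ht.1 ht.2).1 (H.antitoneOn hP hb hα hs ht hst)
    (by linarith)

theorem radialMean_le (H : IsVolterraProfile m b ((m + 1) * b + α) A ψ k h dh)
    (hP : IsPowerOn p R ψ k h dh) (hb : 0 < b) (hα : 0 < α) (hp : 1 < p) {s : ℝ}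
    (hs0 : 0 ≤ s) (hsR : s < R) : radialMean m h s ≤ h s / (m + 1) := by
  rw [← radialMean_const m (h s) s]
  refine radialMean_mono m H.cont_h continuous_const fun τ hτ => ?_
  have : τ ^ 2 * s ≤ s := mul_le_of_le_one_left hs0 (pow_le_one₀ hτ.1 hτ.2)
  exact H.h_monotoneOn hP hb hα hp ⟨by positivity, this.trans_lt hsR⟩ ⟨hs0, hsR⟩ this

theorem le_radialMean (H : IsVolterraProfile m b ((m + 1) * b + α) A ψ k h dh)
    (hP : IsPowerOn p R ψ k h dh) (hb : 0 < b) (hα : 0 < α) (hp : 1 < p) {s : ℝ}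
    (hs0 : 0 ≤ s) (hsR : s < R) : A ^ (1 - p) / (m + 1) ≤ radialMean m h s := by
  rw [← H.zero, ← (hP 0 le_rfl (hs0.trans_lt hsR)).2.1, ← radialMean_const m (h 0) s]
  refine radialMean_mono m continuous_const H.cont_h fun τ hτ => ?_
  have : τ ^ 2 * s ≤ s := mul_le_of_le_one_left hs0 (pow_le_one₀ hτ.1 hτ.2)
  exact H.h_monotoneOn hP hb hα hp ⟨le_rfl, hs0.trans_lt hsR⟩
    ⟨by positivity, this.trans_lt hsR⟩ (by positivity)

theorem hasDerivAt_rpow_mul_radialMean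
    (H : IsVolterraProfile m b ((m + 1) * b + α) A ψ k h dh) (hb : 0 < b) {s : ℝ} (hs : 0 < s) :
    HasDerivAt (fun s => s ^ (-(α / (2 * b))) * radialMean m h s)
      (s ^ (-(α / (2 * b)) - 1) * (k s / b)) s := by
  refine ((Real.hasDerivAt_rpow_const (Or.inl hs.ne')).mul
    (hasDerivAt_radialMean m H.deriv_h H.cont_dh s)).congr_deriv ?_
  have h1 := two_mul_radialMean_deriv m H.deriv_h H.cont_dh s
  have h2 : radialMean (m + 2) dh s = (h s - (m + 1) * radialMean m h s) / (2 * s) := by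
    field_simp
    linarith
  rw [h2, H.k_eq s, Real.rpow_sub_one hs.ne']
  field_simp
  ring

/-- The a priori growth constant for `h`. -/
def growthConst (m : ℕ) (b α p A : ℝ) : ℝ :=
  (A ^ p / 2) ^ ((1 - p) / p) * (1 + ((m + 1) * b + α) / (b * (m + 1)) *
    ((m + 1) * A ^ p / (p * α)) ^ (-(α / (2 * b))))

theorem le_initial (H : IsVolterraProfile m b ((m + 1) * b + α) A ψ k h dh)
    (hP : IsPowerOn p R ψ k h dh) (hb : 0 < b) (hα : 0 < α) (hp : 1 < p) (hA : 0 < A) {s : ℝ}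
    (hs0 : 0 ≤ s) (hsR : s < R) (hs : s ≤ (m + 1) * A ^ p / (p * α)) :
    h s ≤ (A ^ p / 2) ^ ((1 - p) / p) := by
  have hm : (0 : ℝ) < m + 1 := by positivity
  have hAp : 0 < A ^ p := Real.rpow_pos_of_pos hA p
  have hmono : MonotoneOn (fun t => ψ t ^ p + p * α / (2 * (m + 1)) * t) (Set.Icc 0 s) := by
    have hd : ∀ t ∈ Set.Icc 0 s, HasDerivAt (fun t => ψ t ^ p + p * α / (2 * (m + 1)) * t)
        (k t * p * ψ t ^ (p - 1) + p * α / (2 * (m + 1)) * 1) t := fun t ht =>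
      ((H.deriv_ψ t).rpow_const (Or.inr hp.le)).add ((hasDerivAt_id t).const_mul _)
    refine monotoneOn_of_deriv_nonneg (convex_Icc 0 s)
      (fun t ht => (hd t ht).continuousAt.continuousWithinAt)
      (fun t ht => (hd t (interior_subset ht)).differentiableAt.differentiableWithinAt)
      fun t ht => ?_
    have ht' := interior_subset ht
    rw [(hd t ht').deriv]
    obtain ⟨hψ, hh, -⟩ := hP t ht'.1 (ht'.2.trans_lt hsR)
    have h1 := H.radialMean_le hP hb hα hp ht'.1 (ht'.2.trans_lt hsR)
    have h2 : h t * ψ t ^ (p - 1) = 1 := by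
      rw [hh, ← Real.rpow_add hψ]
      simp
    have h3 : -(α / (2 * (m + 1))) * h t ≤ k t := by
      rw [H.k_eq t]
      have : ((m + 1) * b + α) * radialMean m h t ≤ ((m + 1) * b + α) * (h t / (m + 1)) := by
        gcongr
      have e : -(α / (2 * (m + 1))) * h t = (b * h t - ((m + 1) * b + α) * (h t / (m + 1))) / 2 := by
        field_simp
        ring
      rw [e]
      linarith
    have h4 : 0 < ψ t ^ (p - 1) := Real.rpow_pos_of_pos hψ _
    have h5 := mul_le_mul_of_nonneg_right h3 (by positivity : 0 ≤ p * ψ t ^ (p - 1))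
    have h6 : -(α / (2 * (m + 1))) * h t * (p * ψ t ^ (p - 1)) = -(p * α / (2 * (m + 1))) := by
      linear_combination -(p * α / (2 * (m + 1))) * h2
    linarith
  have h1 := hmono ⟨le_rfl, hs0⟩ ⟨hs0, le_rfl⟩ hs0
  simp only [mul_zero, add_zero, H.zero] at h1
  have h2 : p * α / (2 * (m + 1)) * s ≤ A ^ p / 2 := by
    calc _ ≤ p * α / (2 * (m + 1)) * ((m + 1) * A ^ p / (p * α)) := by gcongr
      _ = A ^ p / 2 := by field_simp
  obtain ⟨hψ, hh, -⟩ := hP s hs0 hsR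
  have h3 : ψ s ^ (1 - p) = (ψ s ^ p) ^ ((1 - p) / p) := by
    rw [← Real.rpow_mul hψ.le]
    congr 1
    field_simp
  rw [hh, h3]
  exact Real.rpow_le_rpow_of_nonpos (by positivity) (by linarith)
    (div_nonpos_of_nonpos_of_nonneg (by linarith) (by linarith))

theorem h_le (H : IsVolterraProfile m b ((m + 1) * b + α) A ψ k h dh)
    (hP : IsPowerOn p R ψ k h dh) (hb : 0 < b) (hα : 0 < α) (hp : 1 < p) (hA : 0 < A) {s : ℝ}
    (hs0 : 0 ≤ s) (hsR : s < R) :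
    h s ≤ growthConst m b α p A * (1 + s) ^ (α / (2 * b)) := by
  have hm : (0 : ℝ) < m + 1 := by positivity
  have hAp : 0 < A ^ p := Real.rpow_pos_of_pos hA p
  have hγ : 0 < α / (2 * b) := by positivity
  unfold growthConst
  set σ := (m + 1) * A ^ p / (p * α) with hσ
  set B := (A ^ p / 2) ^ ((1 - p) / p) with hB
  have hσpos : 0 < σ := by positivity
  have hBpos : 0 < B := by positivity
  have h1s : 1 ≤ (1 + s) ^ (α / (2 * b)) := Real.one_le_rpow (by linarith) hγ.le
  rcases le_total s σ with hle | hle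
  · have h1 := H.le_initial hP hb hα hp hA hs0 hsR hle
    refine h1.trans ?_
    have : 1 ≤ 1 + ((m + 1) * b + α) / (b * (m + 1)) * σ ^ (-(α / (2 * b))) := by
      have : 0 ≤ ((m + 1) * b + α) / (b * (m + 1)) * σ ^ (-(α / (2 * b))) := by positivity
      linarith
    rw [mul_assoc]
    exact le_mul_of_one_le_right hBpos.le (one_le_mul_of_one_le_of_one_le this h1s)
  · have hspos : 0 < s := hσpos.trans_le hle
    have hanti : AntitoneOn (fun s => s ^ (-(α / (2 * b))) * radialMean m h s) (Set.Icc σ s) := by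
      have hd : ∀ t ∈ Set.Icc σ s, _ := fun t ht =>
        H.hasDerivAt_rpow_mul_radialMean hb (hσpos.trans_le ht.1)
      refine antitoneOn_of_deriv_nonpos (convex_Icc σ s)
        (fun t ht => (hd t ht).continuousAt.continuousWithinAt)
        (fun t ht => (hd t (interior_subset ht)).differentiableAt.differentiableWithinAt)
        fun t ht => ?_
      have ht' := interior_subset ht
      have htpos := hσpos.trans_le ht'.1
      rw [(hd t ht').deriv]
      exact mul_nonpos_of_nonneg_of_nonpos (by positivity)
        (div_nonpos_of_nonpos_of_nonneg (H.k_nonpos hP hb hα htpos.le (ht'.2.trans_lt hsR)) hb.le)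
    have h1 := hanti ⟨le_rfl, hle⟩ ⟨hle, le_rfl⟩ hle
    dsimp only at h1
    have h2 := H.radialMean_le hP hb hα hp hσpos.le (hle.trans_lt hsR)
    have h3 := H.le_initial hP hb hα hp hA hσpos.le (hle.trans_lt hsR) le_rfl
    have h4 := H.k_nonpos hP hb hα hs0 hsR
    rw [H.k_eq s] at h4
    have h5 : s ^ (-(α / (2 * b))) * radialMean m h s ≤ σ ^ (-(α / (2 * b))) * (B / (m + 1)) := by
      refine h1.trans ?_
      gcongr
      refine h2.trans ?_
      gcongr
    have h6 : radialMean m h s ≤ s ^ (α / (2 * b)) * (σ ^ (-(α / (2 * b))) * (B / (m + 1))) := by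
      calc radialMean m h s = s ^ (α / (2 * b)) * (s ^ (-(α / (2 * b))) * radialMean m h s) := by
            rw [← mul_assoc, ← Real.rpow_add hspos]
            simp
        _ ≤ _ := by gcongr
    have h7 : h s ≤ ((m + 1) * b + α) / b * radialMean m h s := by
      rw [div_mul_eq_mul_div, le_div_iff₀ hb]
      linarith
    have h8 : s ^ (α / (2 * b)) ≤ (1 + s) ^ (α / (2 * b)) := by
      gcongr
      linarith
    calc h s ≤ ((m + 1) * b + α) / b *
          (s ^ (α / (2 * b)) * (σ ^ (-(α / (2 * b))) * (B / (m + 1)))) := by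
          refine h7.trans ?_
          gcongr
      _ = (B * (((m + 1) * b + α) / (b * (m + 1)) * σ ^ (-(α / (2 * b))))) *
          s ^ (α / (2 * b)) := by
          field_simp
      _ ≤ _ := by
          gcongr
          linarith

theorem exists_le_h (H : IsVolterraProfile m b ((m + 1) * b + α) A ψ k h dh)
    (hP : ∀ R, IsPowerOn p R ψ k h dh) (hb : 0 < b) (hα : 0 < α) (hp : 1 < p) (hA : 0 < A) :
    ∃ c, 0 < c ∧ ∀ s, 0 ≤ s → c * (1 + s) ^ (α / (2 * b)) ≤ h s := by
  have hm : (0 : ℝ) < m + 1 := by positivity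
  have hAp : 0 < A ^ p := Real.rpow_pos_of_pos hA p
  have hAp' : 0 < A ^ (1 - p) := Real.rpow_pos_of_pos hA _
  have hγ : 0 < α / (2 * b) := by positivity
  set σ := 2 * (m + 1) * A ^ p / b with hσ
  have hσpos : 0 < σ := by positivity
  set c₁ := σ ^ (-(α / (2 * b))) * (A ^ (1 - p) / 2) with hc₁
  have hc₁pos : 0 < c₁ := by positivity
  have hmono : MonotoneOn (fun s => s ^ (-(α / (2 * b))) * radialMean m h s -
      σ ^ (-(α / (2 * b)) - 1) / b * ψ s) (Set.Ici σ) := by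
    have hd : ∀ t ∈ Set.Ici σ, _ := fun t ht =>
      (H.hasDerivAt_rpow_mul_radialMean hb (hσpos.trans_le ht)).sub
        ((H.deriv_ψ t).const_mul (σ ^ (-(α / (2 * b)) - 1) / b))
    refine monotoneOn_of_deriv_nonneg (convex_Ici σ)
      (fun t ht => (hd t ht).continuousAt.continuousWithinAt)
      (fun t ht => (hd t (interior_subset ht)).differentiableAt.differentiableWithinAt)
      fun t ht => ?_
    have ht' : σ ≤ t := interior_subset ht
    refine (hd t ht').deriv.symm ▸ ?_
    have h1 := H.k_nonpos (hP (t + 1)) hb hα (hσpos.le.trans ht') (by linarith)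
    have h2 : t ^ (-(α / (2 * b)) - 1) ≤ σ ^ (-(α / (2 * b)) - 1) :=
      Real.rpow_le_rpow_of_nonpos hσpos ht' (by linarith)
    have h3 : t ^ (-(α / (2 * b)) - 1) * (k t / b) - σ ^ (-(α / (2 * b)) - 1) / b * k t =
      (σ ^ (-(α / (2 * b)) - 1) - t ^ (-(α / (2 * b)) - 1)) * (-k t / b) := by ring
    rw [h3]
    exact mul_nonneg (by linarith) (div_nonneg (by linarith) hb.le)
  have hlarge : ∀ s, σ ≤ s → c₁ * s ^ (α / (2 * b)) ≤ h s := by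
    intro s hs
    have hspos : 0 < s := hσpos.trans_le hs
    have h1 := hmono (le_refl σ) hs hs
    dsimp only at h1
    have h2 := H.le_radialMean (hP (σ + 1)) hb hα hp hσpos.le (by linarith)
    have h3 := H.radialMean_le (hP (s + 1)) hb hα hp hspos.le (by linarith)
    have h4 : 0 < ψ s := (hP (s + 1) s hspos.le (by linarith)).1
    have h5 : ψ σ ≤ A := by
      rw [← H.zero]
      exact H.antitoneOn (hP (σ + 1)) hb hα ⟨le_rfl, by linarith⟩ ⟨hσpos.le, by linarith⟩ hσpos.le
    have h6 : 0 ≤ σ ^ (-(α / (2 * b)) - 1) / b * ψ s := by positivity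
    have h7 : σ ^ (-(α / (2 * b)) - 1) / b * ψ σ ≤ σ ^ (-(α / (2 * b)) - 1) / b * A := by gcongr
    have h8 : σ ^ (-(α / (2 * b))) * (A ^ (1 - p) / (m + 1)) ≤
        σ ^ (-(α / (2 * b))) * radialMean m h σ := by gcongr
    have h9 : σ ^ (-(α / (2 * b))) * (A ^ (1 - p) / (m + 1)) - σ ^ (-(α / (2 * b)) - 1) / b * A
        = c₁ / (m + 1) := by
      have hA1 : A ^ (1 - p) * A ^ p = A := by
        rw [← Real.rpow_add hA]
        simp
      have e : A / (σ * b) = A ^ (1 - p) / (2 * (m + 1)) := by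
        rw [hσ]
        field_simp
        linarith
      rw [Real.rpow_sub_one hσpos.ne']
      have : σ ^ (-(α / (2 * b))) / σ / b * A = σ ^ (-(α / (2 * b))) * (A / (σ * b)) := by
        field_simp
      rw [this, e, hc₁]
      field_simp
      ring
    have h10 : c₁ / (m + 1) * s ^ (α / (2 * b)) ≤ radialMean m h s := by
      calc _ ≤ (s ^ (-(α / (2 * b))) * radialMean m h s) * s ^ (α / (2 * b)) := by
            gcongr
            linarith
        _ = radialMean m h s * (s ^ (-(α / (2 * b))) * s ^ (α / (2 * b))) := by ring
        _ = radialMean m h s := by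
            rw [← Real.rpow_add hspos]
            simp
    rw [le_div_iff₀ hm] at h3
    rw [div_mul_eq_mul_div, div_le_iff₀ hm] at h10
    exact h10.trans h3
  refine ⟨min (A ^ (1 - p) / (1 + σ) ^ (α / (2 * b))) (c₁ * (σ / (1 + σ)) ^ (α / (2 * b))),
    by positivity, fun s hs => ?_⟩
  rcases le_total s σ with hle | hle
  · have h1 : A ^ (1 - p) ≤ h s := by
      rw [← H.zero, ← (hP 1 0 le_rfl one_pos).2.1]
      exact H.h_monotoneOn (hP (s + 1)) hb hα hp ⟨le_rfl, by linarith⟩ ⟨hs, by linarith⟩ hs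
    calc _ ≤ A ^ (1 - p) / (1 + σ) ^ (α / (2 * b)) * (1 + σ) ^ (α / (2 * b)) := by
          gcongr
          exact min_le_left _ _
      _ = A ^ (1 - p) := div_mul_cancel₀ _ (by positivity)
      _ ≤ h s := h1
  · have h1 : σ / (1 + σ) * (1 + s) ≤ s := by
      rw [div_mul_eq_mul_div, div_le_iff₀ (by positivity)]
      linarith
    calc _ ≤ c₁ * (σ / (1 + σ)) ^ (α / (2 * b)) * (1 + s) ^ (α / (2 * b)) := by
          gcongr
          exact min_le_right _ _
      _ = c₁ * (σ / (1 + σ) * (1 + s)) ^ (α / (2 * b)) := by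
          rw [Real.mul_rpow (by positivity) (by positivity), mul_assoc]
      _ ≤ c₁ * s ^ (α / (2 * b)) := by gcongr
      _ ≤ h s := hlarge s hle

end IsVolterraProfile

theorem growthConst_pos {m : ℕ} {b α p A : ℝ} (hb : 0 < b) (hα : 0 < α) (hp : 1 < p)
    (hA : 0 < A) : 0 < IsVolterraProfile.growthConst m b α p A := by
  unfold IsVolterraProfile.growthConst
  positivity

/-- There is a global profile for which the truncation is never active. -/
theorem exists_global_profile (m : ℕ) {b α p A : ℝ} (hb : 0 < b) (hα : 0 < α) (hp : 1 < p)
    (hA : 0 < A) :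
    ∃ ψ k h dh : ℝ → ℝ, IsVolterraProfile m b ((m + 1) * b + α) A ψ k h dh ∧
      ∀ R, IsPowerOn p R ψ k h dh := by
  set C := IsVolterraProfile.growthConst m b α p A with hCdef
  have hCpos : 0 < C := growthConst_pos hb hα hp hA
  set γ := α / (2 * b) with hγdef
  have hγ : 0 < γ := by positivity
  have hq : 0 < p - 1 := by linarith
  have hC1 : 0 < C + A ^ (1 - p) := by positivity
  obtain ⟨ψ, k, h, dh, H, hE⟩ := exists_truncated_profile m hb
    (by positivity : 0 < (m + 1) * b + α) hp hA hC1 hγ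
  set W : ℝ → ℝ := fun s => (C + A ^ (1 - p)) * (2 + 2 * s ^ 2) ^ γ with hW
  set E : ℝ → ℝ := fun s => W s ^ (p - 1)⁻¹ with hEdef
  have hWpos : ∀ s, 0 < W s := fun s => by simp only [hW]; positivity
  have hEpos : ∀ s, 0 < E s := fun s => Real.rpow_pos_of_pos (hWpos s) _
  have hWc : Continuous W := by
    refine continuous_const.mul (Continuous.rpow_const (by fun_prop) fun s => Or.inr hγ.le)
  have hEc : Continuous E := hWc.rpow_const fun s => Or.inl (hWpos s).ne'
  have hψc := H.cont_ψ
  have hpow : ∀ R, (∀ s, 0 ≤ s → s < R → 1 < E s * ψ s) → IsPowerOn p R ψ k h dh := by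
    intro R hR s hs0 hsR
    have h1 := hR s hs0 hsR
    have h2 : 0 < ψ s := pos_of_mul_pos_right (one_pos.trans h1) (hEpos s).le
    refine ⟨h2, hE s h1.le, ?_⟩
    have h3 : h =ᶠ[nhds s] fun t => ψ t ^ (1 - p) := by
      filter_upwards [(hEc.mul hψc).continuousAt.eventually (lt_mem_nhds h1)] with t ht
      exact hE t (le_of_lt ht)
    have h4 := ((H.deriv_ψ s).rpow_const (p := 1 - p) (Or.inl h2.ne')).congr_of_eventuallyEq h3
    rw [(H.deriv_h s).unique h4]
    ring_nf
  have hlow : ∀ s, 0 < ψ s → h s = ψ s ^ (1 - p) → h s ≤ C * (1 + s) ^ γ → 0 ≤ s →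
      (C * (1 + s) ^ γ) ^ (-(p - 1)⁻¹) ≤ ψ s := by
    intro s hψ hh hle hs
    have e : ψ s = h s ^ (-(p - 1)⁻¹) := by
      rw [hh, ← Real.rpow_mul hψ.le,
        show (1 - p) * -(p - 1)⁻¹ = 1 by field_simp; ring, Real.rpow_one]
    rw [e]
    exact Real.rpow_le_rpow_of_nonpos (by rw [hh]; positivity) hle
      (neg_nonpos.2 (inv_nonneg.2 hq.le))
  have hmain : ∀ s, 0 ≤ s → 1 < E s * ψ s := by
    by_contra! hcon
    obtain ⟨s₀, hs₀, hs₀'⟩ := hcon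
    have hcl : IsClosed {s | E s * ψ s ≤ 1} := isClosed_le (hEc.mul hψc) continuous_const
    obtain ⟨r, ⟨⟨hr0, hrs⟩, hr1⟩, hrmin⟩ :=
      (isCompact_Icc.inter_right hcl : IsCompact (Set.Icc 0 s₀ ∩ {s | E s * ψ s ≤ 1})).exists_isLeast
        ⟨s₀, ⟨hs₀, le_rfl⟩, hs₀'⟩
    have hr1 : E r * ψ r ≤ 1 := hr1
    have hlt : ∀ s, 0 ≤ s → s < r → 1 < E s * ψ s := by
      intro s hs hsr
      by_contra hcon
      exact absurd (hrmin ⟨⟨hs, hsr.le.trans hrs⟩, not_lt.1 hcon⟩) (not_le.2 hsr)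
    have hP := hpow r hlt
    have hbound : (W r) ^ (-(p - 1)⁻¹) < ψ r := by
      have hr2 : (1 + r) ^ γ ≤ (2 + 2 * r ^ 2) ^ γ := by
        refine Real.rpow_le_rpow (by linarith) ?_ hγ.le
        nlinarith [sq_nonneg (r - 1)]
      have hr3 : 0 < (1 + r) ^ γ := by positivity
      have hAp : 0 < A ^ (1 - p) := by positivity
      rcases hr0.eq_or_lt with h0 | h0
      · have e : ψ r = (A ^ (1 - p)) ^ (-(p - 1)⁻¹) := by
          rw [← h0, H.zero, ← Real.rpow_mul hA.le,
            show (1 - p) * -(p - 1)⁻¹ = 1 by field_simp; ring, Real.rpow_one]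
        rw [e]
        refine Real.rpow_lt_rpow_of_neg hAp ?_ (neg_neg_of_pos (inv_pos.2 hq))
        have : 1 ≤ (1 + r) ^ γ := Real.one_le_rpow (by linarith) hγ.le
        simp only [hW]
        nlinarith
      · have h1 : (C * (1 + r) ^ γ) ^ (-(p - 1)⁻¹) ≤ ψ r := by
          have hcont : ContinuousAt (fun s => (C * (1 + s) ^ γ) ^ (-(p - 1)⁻¹)) r :=
            ContinuousAt.rpow_const (continuousAt_const.mul
              (ContinuousAt.rpow_const (by fun_prop) (Or.inr hγ.le))) (Or.inl (by positivity))
          refine le_of_tendsto_of_tendsto (b := nhdsWithin r (Set.Iio r))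
            (hcont.tendsto.mono_left nhdsWithin_le_nhds)
            (hψc.continuousAt.tendsto.mono_left nhdsWithin_le_nhds) ?_
          filter_upwards [Ioo_mem_nhdsLT h0] with s hs
          obtain ⟨h2, h3, -⟩ := hP s hs.1.le hs.2
          exact hlow s h2 h3 (H.h_le hP hb hα hp hA hs.1.le hs.2) hs.1.le
        refine lt_of_lt_of_le ?_ h1
        refine Real.rpow_lt_rpow_of_neg (by positivity) ?_ (neg_neg_of_pos (inv_pos.2 hq))
        simp only [hW]
        nlinarith
    have h5 : E r * W r ^ (-(p - 1)⁻¹) = 1 := by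
      rw [hEdef, ← Real.rpow_add (hWpos r)]
      simp
    have := mul_lt_mul_of_pos_left hbound (hEpos r)
    linarith
  exact ⟨ψ, k, h, dh, H, fun R => hpow R fun s hs _ => hmain s hs⟩

/-- The profile in the variable `σ = ξ²`. -/
theorem exists_radial_profile (m : ℕ) {α β p A : ℝ} (hβ : 0 < β) (hα : 0 < α) (hp : 1 < p)
    (hA : 0 < A) :
    ∃ ψ k dk : ℝ → ℝ, ψ 0 = A ∧ (∀ s, HasDerivAt ψ (k s) s) ∧ (∀ s, HasDerivAt k (dk s) s) ∧
      Continuous dk ∧ (∀ s, 0 ≤ s → 0 < ψ s) ∧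
      (∀ s, 0 ≤ s →
        ψ s ^ p * (4 * s * dk s + 2 * (m + 1) * k s) + 2 * β * s * k s + α * ψ s = 0) ∧
      ∃ c, 0 < c ∧ ∃ C, 0 < C ∧ ∀ s, 0 ≤ s →
        c * (1 + s) ^ (-(α / (2 * β))) ≤ ψ s ∧ ψ s ≤ C * (1 + s) ^ (-(α / (2 * β))) := by
  have hq : 0 < p - 1 := by linarith
  set b := β / (p - 1) with hb
  have hbpos : 0 < b := by positivity
  obtain ⟨ψ, k, h, dh, H, hP⟩ := exists_global_profile m hbpos hα hp hA
  have hP' : ∀ s, 0 ≤ s → 0 < ψ s ∧ h s = ψ s ^ (1 - p) ∧ dh s = (1 - p) * ψ s ^ (-p) * k s :=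
    fun s hs => hP (s + 1) s hs (by linarith)
  have hψh : ∀ s, 0 ≤ s → ψ s = h s ^ (-(p - 1)⁻¹) := by
    intro s hs
    rw [(hP' s hs).2.1, ← Real.rpow_mul (hP' s hs).1.le,
      show (1 - p) * -(p - 1)⁻¹ = 1 by field_simp; ring, Real.rpow_one]
  have hneg : -(p - 1)⁻¹ ≤ 0 := neg_nonpos.2 (inv_nonneg.2 hq.le)
  have hexp : ∀ c s : ℝ, 0 < c → 0 ≤ s → (c * (1 + s) ^ (α / (2 * b))) ^ (-(p - 1)⁻¹) =
      c ^ (-(p - 1)⁻¹) * (1 + s) ^ (-(α / (2 * β))) := by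
    intro c s hc hs
    rw [Real.mul_rpow hc.le (by positivity), ← Real.rpow_mul (by positivity)]
    congr 2
    rw [hb]
    field_simp
  refine ⟨ψ, k, _, H.zero, H.deriv_ψ, H.deriv_k, ?_, fun s hs => (hP' s hs).1, fun s hs => ?_, ?_⟩
  · have := continuous_radialMean (m + 2) H.cont_dh
    have := H.cont_dh
    fun_prop
  · obtain ⟨h1, h2, h3⟩ := hP' s hs
    have h4 := two_mul_radialMean_deriv m H.deriv_h H.cont_dh s
    have h5 := H.k_eq s
    have e1 : ψ s ^ p * ψ s ^ (1 - p) = ψ s := by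
      rw [← Real.rpow_add h1]
      simp
    have e2 : ψ s ^ p * ψ s ^ (-p) = 1 := by
      rw [← Real.rpow_add h1]
      simp
    have e3 : b * (p - 1) = β := div_mul_cancel₀ _ hq.ne'
    have key : 4 * s * ((b * dh s - ((m + 1) * b + α) * radialMean (m + 2) dh s) / 2) +
        2 * (m + 1) * k s = -2 * β * s * ψ s ^ (-p) * k s - α * ψ s ^ (1 - p) := by
      rw [← h2]
      linear_combination (-((m + 1) * b + α)) * h4 + 2 * (m + 1) * h5 + 2 * s * b * h3 -
        2 * s * ψ s ^ (-p) * k s * e3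
    rw [key]
    linear_combination (-2 * β * s * k s) * e2 - α * e1
  · obtain ⟨c, hc, hle⟩ := H.exists_le_h hP hbpos hα hp hA
    have hC := growthConst_pos (m := m) hbpos hα hp hA
    refine ⟨_, Real.rpow_pos_of_pos hC (-(p - 1)⁻¹), _, Real.rpow_pos_of_pos hc (-(p - 1)⁻¹),
      fun s hs => ⟨?_, ?_⟩⟩
    · rw [← hexp _ _ hC hs, hψh s hs]
      refine Real.rpow_le_rpow_of_nonpos ?_
        (H.h_le (hP (s + 1)) hbpos hα hp hA hs (by linarith)) hneg
      rw [(hP' s hs).2.1]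
      exact Real.rpow_pos_of_pos (hP' s hs).1 _
    · rw [← hexp _ _ hc hs, hψh s hs]
      exact Real.rpow_le_rpow_of_nonpos (by positivity) (hle s hs) hneg

theorem lap_comp_norm_sq (n : ℕ) {ψ k dk : ℝ → ℝ} (hψ : ∀ s, HasDerivAt ψ (k s) s)
    (hk : ∀ s, HasDerivAt k (dk s) s) (a q : ℝ) (x : Euc n) :
    lap n (fun y => a * ψ (q * ‖y‖ ^ 2)) x =
      a * q * (4 * (q * ‖x‖ ^ 2) * dk (q * ‖x‖ ^ 2) + 2 * n * k (q * ‖x‖ ^ 2)) := by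
  have hsq : ∀ y : Euc n, HasFDerivAt (fun y : Euc n => q * ‖y‖ ^ 2)
      (q • (2 • innerSL ℝ y)) y := fun y =>
    (hasStrictFDerivAt_norm_sq y).hasFDerivAt.const_mul q
  have h1 : ∀ y : Euc n, HasFDerivAt (fun y : Euc n => a * ψ (q * ‖y‖ ^ 2))
      ((2 * a * q * k (q * ‖y‖ ^ 2)) • innerSL ℝ y) y := by
    intro y
    refine (((hψ _).comp_hasFDerivAt y (hsq y)).const_mul a).congr_fderiv ?_
    ext v
    simp
    ring
  have h2 : HasFDerivAt (fun y : Euc n => (2 * a * q * k (q * ‖y‖ ^ 2)) • innerSL ℝ y) _ x :=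
    (((hk _).comp_hasFDerivAt x (hsq x)).const_mul (2 * a * q)).smul
      (innerSL ℝ : Euc n →L[ℝ] Euc n →L[ℝ] ℝ).hasFDerivAt
  have h3 : ∀ i : Fin n, iteratedFDeriv ℝ 2 (fun y : Euc n => a * ψ (q * ‖y‖ ^ 2)) x
      ![EuclideanSpace.single i 1, EuclideanSpace.single i 1] =
      4 * a * q ^ 2 * dk (q * ‖x‖ ^ 2) * x i ^ 2 + 2 * a * q * k (q * ‖x‖ ^ 2) := by
    intro i
    rw [iteratedFDeriv_two_apply, show fderiv ℝ (fun y : Euc n => a * ψ (q * ‖y‖ ^ 2)) = _ from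
      funext fun y => (h1 y).fderiv, h2.fderiv]
    have hi : innerSL ℝ (EuclideanSpace.single i (1 : ℝ)) (EuclideanSpace.single i 1) = 1 := by
      rw [innerSL_apply_apply, real_inner_self_eq_norm_sq]
      simp
    simp [EuclideanSpace.inner_single_right, hi]
    ring
  unfold lap
  simp only [h3]
  rw [Finset.sum_add_distrib, ← Finset.mul_sum, ← EuclideanSpace.real_norm_sq_eq]
  simp
  ring

/-- Theorem (self-similar solutions): for `p > 1`, `α ∈ (0,1/p)`, `A > 0` and
`β = (1-pα)/2` there is a positive profile `f ∈ C¹([0,∞)) ∩ C²((0,∞))` with `f(0) = A`,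
`f'(0) = 0`, solving the profile ODE, enjoying the two-sided bound
`c(1+ξ)^{-α/β} ≤ f(ξ) ≤ C(1+ξ)^{-α/β}`, and such that `u(x,t) = t^{-α} f(t^{-β}|x|)`
is a positive classical solution of `∂ₜ u = uᵖ Δu` on `ℝⁿ × (0,∞)`. -/
theorem stmt6 (n : ℕ) (hn : 1 ≤ n) (p α A β : ℝ) (hp : 1 < p) (hα : 0 < α)
    (hαp : α < 1 / p) (hA : 0 < A) (hβ : β = (1 - p * α) / 2) :
    ∃ f : ℝ → ℝ,
      ContDiffOn ℝ 1 f (Set.Ici 0) ∧ ContDiffOn ℝ 2 f (Set.Ioi 0) ∧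
      f 0 = A ∧ derivWithin f (Set.Ici 0) 0 = 0 ∧
      (∀ ξ : ℝ, 0 ≤ ξ → 0 < f ξ) ∧
      (∀ ξ : ℝ, 0 < ξ →
        f ξ ^ p * (deriv (deriv f) ξ + ((n : ℝ) - 1) * ξ⁻¹ * deriv f ξ)
          + β * ξ * deriv f ξ + α * f ξ = 0) ∧
      (∃ c : ℝ, 0 < c ∧ ∃ C : ℝ, 0 < C ∧ ∀ ξ : ℝ, 0 ≤ ξ →
        c * (1 + ξ) ^ (-(α / β)) ≤ f ξ ∧ f ξ ≤ C * (1 + ξ) ^ (-(α / β))) ∧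
      (∀ x : Euc n, ∀ t : ℝ, 0 < t → 0 < t ^ (-α) * f (t ^ (-β) * ‖x‖)) ∧
      (∀ t : ℝ, 0 < t → ContDiff ℝ 2 fun x : Euc n => t ^ (-α) * f (t ^ (-β) * ‖x‖)) ∧
      (∀ x : Euc n, ∀ t : ℝ, 0 < t →
        HasDerivAt (fun s : ℝ => s ^ (-α) * f (s ^ (-β) * ‖x‖))
          ((t ^ (-α) * f (t ^ (-β) * ‖x‖)) ^ p *
            lap n (fun y : Euc n => t ^ (-α) * f (t ^ (-β) * ‖y‖)) x) t) := by
  obtain ⟨m, rfl⟩ : ∃ m, n = m + 1 := ⟨n - 1, by omega⟩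
  have hp0 : 0 < p := by linarith
  have hβpos : 0 < β := by
    rw [lt_div_iff₀ hp0] at hαp
    rw [hβ]
    linarith
  obtain ⟨ψ, k, dk, h0, hψ, hk, hdk, hpos, hode, c, hc, C, hC, hbd⟩ :=
    exists_radial_profile m hβpos hα hp hA
  have hkd : ContDiff ℝ 1 k := by
    rw [contDiff_one_iff_deriv]
    refine ⟨fun s => (hk s).differentiableAt, ?_⟩
    rwa [show deriv k = dk from funext fun s => (hk s).deriv]
  have hψd : ContDiff ℝ 2 ψ := by
    rw [show (2 : WithTop ℕ∞) = 1 + 1 by norm_num, contDiff_succ_iff_deriv]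
    refine ⟨fun s => (hψ s).differentiableAt, by simp, ?_⟩
    rwa [show deriv ψ = k from funext fun s => (hψ s).deriv]
  have hfd : ContDiff ℝ 2 fun ξ : ℝ => ψ (ξ ^ 2) := hψd.comp (by fun_prop)
  have hsq : ∀ ξ : ℝ, HasDerivAt (fun ξ : ℝ => ξ ^ 2) (2 * ξ) ξ := fun ξ => by
    simpa using hasDerivAt_pow 2 ξ
  have hf1 : ∀ ξ : ℝ, HasDerivAt (fun ξ : ℝ => ψ (ξ ^ 2)) (k (ξ ^ 2) * (2 * ξ)) ξ := fun ξ =>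
    (hψ _).comp ξ (hsq ξ)
  have hf2 : ∀ ξ : ℝ, HasDerivAt (fun ξ : ℝ => k (ξ ^ 2) * (2 * ξ))
      (dk (ξ ^ 2) * (2 * ξ) * (2 * ξ) + k (ξ ^ 2) * (2 * 1)) ξ := fun ξ =>
    ((hk _).comp ξ (hsq ξ)).mul ((hasDerivAt_id ξ).const_mul 2)
  have hα2 : α / (2 * β) * 2 = α / β := by field_simp
  refine ⟨fun ξ => ψ (ξ ^ 2), (hfd.of_le (by norm_num)).contDiffOn, hfd.contDiffOn,
    by simpa using h0, ?_, fun ξ _ => hpos _ (sq_nonneg ξ), fun ξ hξ => ?_, ?_,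
    fun x t ht => ?_, fun t ht => ?_, fun x t ht => ?_⟩
  · rw [(hf1 0).hasDerivWithinAt.derivWithin (uniqueDiffOn_Ici 0 0 Set.self_mem_Ici)]
    simp
  · rw [show deriv (fun ξ : ℝ => ψ (ξ ^ 2)) = _ from funext fun ξ => (hf1 ξ).deriv, (hf2 ξ).deriv]
    have e : dk (ξ ^ 2) * (2 * ξ) * (2 * ξ) + k (ξ ^ 2) * (2 * 1) +
        (((m + 1 : ℕ) : ℝ) - 1) * ξ⁻¹ * (k (ξ ^ 2) * (2 * ξ)) =
        4 * ξ ^ 2 * dk (ξ ^ 2) + 2 * (m + 1) * k (ξ ^ 2) := by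
      push_cast
      field_simp
      ring
    dsimp only
    rw [e, ← hode (ξ ^ 2) (sq_nonneg ξ)]
    ring
  · refine ⟨c, hc, C * 2 ^ (α / (2 * β)), by positivity, fun ξ hξ => ?_⟩
    obtain ⟨h1, h2⟩ := hbd (ξ ^ 2) (sq_nonneg ξ)
    have e : (1 + ξ) ^ (-(α / β)) = ((1 + ξ) ^ 2) ^ (-(α / (2 * β))) := by
      rw [← Real.rpow_natCast (1 + ξ) 2, ← Real.rpow_mul (by linarith), ← hα2]
      congr 1
      push_cast
      ring
    have hneg : -(α / (2 * β)) ≤ 0 := by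
      have : 0 < α / (2 * β) := by positivity
      linarith
    rw [e]
    refine ⟨le_trans ?_ h1, h2.trans ?_⟩
    · refine mul_le_mul_of_nonneg_left ?_ hc.le
      exact Real.rpow_le_rpow_of_nonpos (by positivity) (by nlinarith) hneg
    · rw [mul_assoc]
      refine mul_le_mul_of_nonneg_left ?_ hC.le
      have h3 : (2 : ℝ) ^ (α / (2 * β)) = (1 / 2) ^ (-(α / (2 * β))) := by
        rw [Real.rpow_neg (by norm_num), ← Real.inv_rpow (by norm_num)]
        norm_num
      rw [h3, ← Real.mul_rpow (by norm_num) (by positivity)]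
      exact Real.rpow_le_rpow_of_nonpos (by positivity) (by nlinarith [sq_nonneg (ξ - 1)]) hneg
  · exact mul_pos (Real.rpow_pos_of_pos ht _) (hpos _ (sq_nonneg _))
  · simp only [mul_pow]
    exact contDiff_const.mul (hψd.comp (contDiff_const.mul (contDiff_norm_sq ℝ)))
  · have e1 : HasDerivAt (fun s : ℝ => (s ^ (-β) * ‖x‖) ^ 2)
        (-2 * β * t⁻¹ * (t ^ (-β) * ‖x‖) ^ 2) t := by
      refine (((Real.hasDerivAt_rpow_const (p := -β) (Or.inl ht.ne')).mul_const ‖x‖).pow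
        2).congr_deriv ?_
      rw [Real.rpow_sub_one ht.ne']
      push_cast
      field_simp
    have e2 := (Real.hasDerivAt_rpow_const (p := -α) (Or.inl ht.ne')).mul
      ((hψ _).comp t e1)
    refine e2.congr_deriv ?_
    simp only [mul_pow]
    rw [lap_comp_norm_sq (m + 1) hψ hk]
    have e3 := hode ((t ^ (-β)) ^ 2 * ‖x‖ ^ 2) (by positivity)
    set σ := (t ^ (-β)) ^ 2 * ‖x‖ ^ 2 with hσ
    have hψσ := hpos σ (by positivity)
    have e4 : (t ^ (-α)) ^ p * (t ^ (-β)) ^ 2 = t⁻¹ := by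
      rw [← Real.rpow_mul ht.le, ← Real.rpow_natCast (t ^ (-β)), ← Real.rpow_mul ht.le,
        ← Real.rpow_add ht, ← Real.rpow_neg_one]
      congr 1
      rw [hβ]
      push_cast
      ring
    rw [Real.mul_rpow (by positivity) hψσ.le, Real.rpow_sub_one ht.ne']
    simp only [Function.comp, ← hσ]
    push_cast
    have e5 : (t ^ (-α)) ^ p * ψ σ ^ p * (t ^ (-α) * (t ^ (-β)) ^ 2 *
        (4 * σ * dk σ + 2 * (m + 1) * k σ)) =
        t⁻¹ * t ^ (-α) * (ψ σ ^ p * (4 * σ * dk σ + 2 * (m + 1) * k σ)) := by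
      rw [← e4]
      ring
    rw [e5, show ψ σ ^ p * (4 * σ * dk σ + 2 * (m + 1) * k σ) =
      -(2 * β * σ * k σ + α * ψ σ) by linarith]
    rw [div_eq_mul_inv]
    ring
end
end

section
/- Let n ≥ 1, p ≥ 1, let u₀ : ℝⁿ → ℝ be continuous, bounded and everywhere positive with u₀(x) ≥ C₀ (1+|x|)^{−γ} for all x ∈ ℝⁿ, where C₀ > 0 and γ > 0. Then every global positive classical solution u of the Cauchy problem (P) with initial data u₀ has the property that for each q ∈ (n/γ, ∞] there exists C > 0 with ‖u(·,t)‖_{L^q(ℝⁿ)} ≥ C · t^{−(γ−n/q)/(pγ+2)} for all t > 1 (for q = ∞ the term n/q is interpreted as 0). -/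
open MeasureTheory
open scoped ENNReal
noncomputable section

theorem deriv_nonpos_of_le_left {f : ℝ → ℝ} {f' a : ℝ} (hf : HasDerivAt f f' a)
    (h : ∀ᶠ s in nhdsWithin a (Set.Iio a), f a ≤ f s) : f' ≤ 0 := by
  have ht : Filter.Tendsto (slope f a) (nhdsWithin a (Set.Iio a)) (nhds f') :=
    hf.tendsto_slope.mono_left (nhdsWithin_mono _ fun x hx => ne_of_lt hx)
  refine le_of_tendsto ht ?_
  filter_upwards [h, self_mem_nhdsWithin] with s hs hsa
  rw [slope_def_field]
  exact div_nonpos_of_nonneg_of_nonpos (sub_nonneg.2 hs) (sub_nonpos.2 (le_of_lt hsa))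

theorem deriv_deriv_line {E : Type*} [NormedAddCommGroup E] [NormedSpace ℝ E] {f : E → ℝ}
    (hf : ContDiff ℝ 2 f) (x e : E) :
    deriv (deriv fun h : ℝ => f (x + h • e)) 0 = iteratedFDeriv ℝ 2 f x ![e, e] := by
  have hline (h : ℝ) : HasDerivAt (fun h : ℝ => x + h • e) e h := by
    simpa using ((hasDerivAt_id h).smul_const e).const_add x
  have h1 : (deriv fun h : ℝ => f (x + h • e)) = fun h => fderiv ℝ f (x + h • e) e := by
    ext h
    exact ((hf.differentiable (by norm_num) _).hasFDerivAt.comp_hasDerivAt h (hline h)).deriv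
  have hd : Differentiable ℝ (fderiv ℝ f) :=
    (hf.fderiv_right (m := 1) (by norm_num)).differentiable (by norm_num)
  have h2 := (hd (x + (0 : ℝ) • e)).hasFDerivAt.comp_hasDerivAt (0 : ℝ) (hline 0)
  rw [h1, iteratedFDeriv_two_apply]
  have h3 := (h2.clm_apply (hasDerivAt_const (0 : ℝ) e)).deriv
  simpa using h3

/-- A function touching the paraboloid `a (1 - ‖x‖² / R²)` from above has Laplacian at least
that of the paraboloid. -/
theorem lap_ge_of_isLocalMin {n : ℕ} {f : Euc n → ℝ} (hf : ContDiff ℝ 2 f) {x : Euc n}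
    {a R : ℝ} (h : IsLocalMin (fun y => f y - a * (1 - ‖y‖ ^ 2 / R ^ 2)) x) :
    -(2 * n * a / R ^ 2) ≤ lap n f x := by
  have key (i : Fin n) : -(2 * a / R ^ 2) ≤ iteratedFDeriv ℝ 2 f x
      ![EuclideanSpace.single i 1, EuclideanSpace.single i 1] := by
    set e : Euc n := EuclideanSpace.single i 1 with he
    have hn : ‖e‖ = 1 := by simp [he]
    have hexp (s : ℝ) : ‖x + s • e‖ ^ 2 = ‖x‖ ^ 2 + 2 * s * inner ℝ x e + s ^ 2 := by
      rw [norm_add_sq_real, inner_smul_right, norm_smul, hn]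
      simp; ring
    set U : ℝ → ℝ := fun s => f (x + s • e)
    have hU : ContDiff ℝ 2 U := hf.comp (by fun_prop)
    set g : ℝ → ℝ := fun s => U s - a * (1 - (‖x‖ ^ 2 + 2 * s * inner ℝ x e + s ^ 2) / R ^ 2)
    have hg : IsLocalMin g 0 := by
      have hc : Filter.Tendsto (fun s : ℝ => x + s • e) (nhds 0) (nhds x) := by
        have : ContinuousAt (fun s : ℝ => x + s • e) 0 := by fun_prop
        simpa [ContinuousAt] using this
      filter_upwards [hc.eventually h] with s hs
      simpa [g, U, hexp] using hs
    have hUd : Differentiable ℝ U := hU.differentiable (by norm_num)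
    have hUd' : Differentiable ℝ (deriv U) :=
      by
      have : ContDiff ℝ 1 (deriv U) :=
        (contDiff_succ_iff_deriv.1 (show ContDiff ℝ (1 + 1) U by norm_num; exact hU)).2.2
      exact this.differentiable (by norm_num)
    have hg1 : deriv g = fun s => deriv U s + a * ((2 * inner ℝ x e + 2 * s) / R ^ 2) := by
      ext s
      have h1 : HasDerivAt (fun s : ℝ => ‖x‖ ^ 2 + 2 * s * inner ℝ x e + s ^ 2)
          (2 * inner ℝ x e + 2 * s) s := by
        have := ((((hasDerivAt_id s).const_mul 2).mul_const (inner ℝ x e)).const_add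
          (‖x‖ ^ 2)).add ((hasDerivAt_id s).pow 2)
        exact this.congr_deriv (by simp)
      have := (hUd s).hasDerivAt.sub (((h1.div_const (R ^ 2)).const_sub 1).const_mul a)
      exact this.deriv.trans (by ring)
    have hg2 : deriv (deriv g) 0 = deriv (deriv U) 0 + 2 * a / R ^ 2 := by
      rw [hg1]
      have := (hUd' 0).hasDerivAt.add (((((hasDerivAt_id (0 : ℝ)).const_mul 2).const_add
        (2 * inner ℝ x e)).div_const (R ^ 2)).const_mul a)
      exact this.deriv.trans (by ring)
    have hc : ContinuousAt g 0 := by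
      have := hU.continuous
      fun_prop
    have := deriv_deriv_nonneg_of_isLocalMin hg hc
    rw [hg2, deriv_deriv_line hf] at this
    linarith
  calc -(2 * n * a / R ^ 2) = ∑ _i : Fin n, -(2 * a / R ^ 2) := by simp; ring
    _ ≤ lap n f x := Finset.sum_le_sum fun i _ => key i

/-- Comparison of a positive global solution with a separated subsolution
`y(t) (1 - ‖x‖² / R²)` on a ball. -/
theorem IsSolP.subsolution_lt {n : ℕ} {p : ℝ} {u₀ : Euc n → ℝ} {u : Euc n → ℝ → ℝ}
    (hp : 1 ≤ p) (hu : IsSolP n p u₀ u ⊤) (hupos : PosOn n u ⊤) {R κ : ℝ} (hR : 0 < R)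
    (hκ : 2 * n < κ) {y : ℝ → ℝ} (hypos : ∀ s, 0 ≤ s → 0 < y s)
    (hyd : ∀ s, 0 ≤ s → HasDerivAt y (-(κ / R ^ 2 * y s ^ (p + 1))) s)
    (hy0 : ∀ x : Euc n, ‖x‖ ≤ R → y 0 < u₀ x) {x : Euc n} (hx : ‖x‖ ≤ R) {t : ℝ}
    (ht : 0 ≤ t) : y t * (1 - ‖x‖ ^ 2 / R ^ 2) < u x t := by
  set w : Euc n × ℝ → ℝ := fun z => u z.1 z.2 - y z.2 * (1 - ‖z.1‖ ^ 2 / R ^ 2)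
  set K : Set (Euc n × ℝ) := Metric.closedBall 0 R ×ˢ Set.Icc 0 t
  have hK : IsCompact K := (isCompact_closedBall _ _).prod isCompact_Icc
  have hw : ContinuousOn w K := by
    have h1 : ContinuousOn (fun z : Euc n × ℝ => u z.1 z.2) K :=
      hu.cont.mono fun z hz => ⟨hz.2.1, ENNReal.ofReal_lt_top⟩
    have h2 : ContinuousOn (fun z : Euc n × ℝ => y z.2) K := by
      have : ContinuousOn y (Set.Icc 0 t) := fun s hs => (hyd s hs.1).continuousAt.continuousWithinAt
      exact this.comp continuousOn_snd fun z hz => hz.2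
    exact h1.sub (h2.mul (by fun_prop))
  by_contra! hcon
  set Z : Set (Euc n × ℝ) := K ∩ w ⁻¹' Set.Iic 0
  have hZ : IsCompact Z := hK.of_isClosed_subset
    (hw.preimage_isClosed_of_isClosed hK.isClosed isClosed_Iic) Set.inter_subset_left
  have hZne : Z.Nonempty :=
    ⟨(x, t), ⟨by simpa using hx, ht, le_rfl⟩, by simpa [w] using hcon⟩
  obtain ⟨⟨x₀, s₀⟩, ⟨⟨hx₀, hs₀, hst⟩, hw0⟩, hmin⟩ :=
    hZ.exists_isMinOn hZne continuousOn_snd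
  replace hx₀ : ‖x₀‖ ≤ R := by simpa using hx₀
  simp only at hs₀ hst
  have hpos_of_lt (z : Euc n) (hz : ‖z‖ ≤ R) (s : ℝ) (hs : 0 ≤ s) (hss : s < s₀) :
      0 < w (z, s) := by
    by_contra! hle
    have := hmin (show (z, s) ∈ Z from ⟨⟨by simpa using hz, hs, hss.le.trans hst⟩, hle⟩)
    exact absurd this (not_le.2 hss)
  have hu_pos := hupos x₀ s₀ hs₀ ENNReal.ofReal_lt_top
  have hy := hypos s₀ hs₀
  have hw0' : u x₀ s₀ ≤ y s₀ * (1 - ‖x₀‖ ^ 2 / R ^ 2) := by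
    simpa [w] using hw0
  have hφ0 : 0 < 1 - ‖x₀‖ ^ 2 / R ^ 2 := by
    by_contra! hle
    exact absurd (hu_pos.trans_le hw0') (not_lt.2 (mul_nonpos_of_nonneg_of_nonpos hy.le hle))
  have hφ1 : 1 - ‖x₀‖ ^ 2 / R ^ 2 ≤ 1 := by
    have : 0 ≤ ‖x₀‖ ^ 2 / R ^ 2 := by positivity
    linarith
  have hx₀lt : ‖x₀‖ < R := by
    rw [sub_pos, div_lt_one (by positivity)] at hφ0
    exact lt_of_pow_lt_pow_left₀ 2 hR.le hφ0
  have hs₀pos : 0 < s₀ := by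
    refine hs₀.lt_of_ne fun h => ?_
    rw [← h, hu.init] at hw0'
    have h0 := hypos 0 le_rfl
    nlinarith [hy0 x₀ hx₀]
  have hnonneg (z : Euc n) (hz : ‖z‖ ≤ R) : 0 ≤ w (z, s₀) := by
    have hc : ContinuousWithinAt (fun s => w (z, s)) (Set.Icc 0 t) s₀ := by
      have h1 : ContinuousOn (fun s => w (z, s)) (Set.Icc 0 t) :=
        hw.comp (by fun_prop) fun s hs => ⟨by simpa using hz, hs⟩
      exact h1 s₀ ⟨hs₀, hst⟩
    have hc' : Filter.Tendsto (fun s => w (z, s)) (nhdsWithin s₀ (Set.Ioo 0 s₀))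
        (nhds (w (z, s₀))) :=
      hc.mono fun s hs => ⟨hs.1.le, hs.2.le.trans hst⟩
    have : (nhdsWithin s₀ (Set.Ioo 0 s₀)).NeBot := by
      rw [nhdsWithin_Ioo_eq_nhdsLT hs₀pos]; infer_instance
    refine ge_of_tendsto hc' ?_
    filter_upwards [self_mem_nhdsWithin] with s hs using (hpos_of_lt z hz s hs.1.le hs.2).le
  have hw_eq : w (x₀, s₀) = 0 := le_antisymm hw0 (hnonneg x₀ hx₀)
  have hu_eq : u x₀ s₀ = y s₀ * (1 - ‖x₀‖ ^ 2 / R ^ 2) := by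
    simpa [w, sub_eq_zero] using hw_eq
  have hlap := lap_ge_of_isLocalMin (a := y s₀) (R := R) (x := x₀)
    (hu.reg_space s₀ hs₀pos ENNReal.ofReal_lt_top) (by
      have : Metric.ball (0 : Euc n) R ∈ nhds x₀ :=
        Metric.isOpen_ball.mem_nhds (by simpa using hx₀lt)
      filter_upwards [this] with z hz
      have hz' : ‖z‖ < R := by simpa using hz
      change w (x₀, s₀) ≤ w (z, s₀)
      rw [hw_eq]
      exact hnonneg z hz'.le)
  have hderiv := deriv_nonpos_of_le_left (f := fun s => w (x₀, s))
    ((hu.reg_time x₀ s₀ hs₀pos ENNReal.ofReal_lt_top).hasDerivAt.sub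
      ((hyd s₀ hs₀).mul_const (1 - ‖x₀‖ ^ 2 / R ^ 2))) (by
      have : Set.Ioo 0 s₀ ∈ nhdsWithin s₀ (Set.Iio s₀) := Ioo_mem_nhdsLT hs₀pos
      filter_upwards [this] with s hs
      simp only [hw_eq]
      exact (hpos_of_lt x₀ hx₀ s hs.1.le hs.2).le)
  rw [hu.pde x₀ s₀ hs₀pos ENNReal.ofReal_lt_top] at hderiv
  set φ := 1 - ‖x₀‖ ^ 2 / R ^ 2
  have hφp : φ ^ p ≤ φ := by
    simpa using Real.rpow_le_rpow_of_exponent_ge hφ0 hφ1 hp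
  have hmul : u x₀ s₀ ^ p * -(2 * n * y s₀ / R ^ 2) ≤ u x₀ s₀ ^ p * lap n (fun z => u z s₀) x₀ :=
    mul_le_mul_of_nonneg_left hlap (by positivity)
  have hup : u x₀ s₀ ^ p = y s₀ ^ p * φ ^ p := by
    rw [hu_eq, Real.mul_rpow hy.le hφ0.le]
  have hyp : y s₀ ^ (p + 1) = y s₀ ^ p * y s₀ := by
    rw [Real.rpow_add hy, Real.rpow_one]
  have hD : 0 < y s₀ ^ p * y s₀ / R ^ 2 := by positivity
  have h1 : u x₀ s₀ ^ p * -(2 * n * y s₀ / R ^ 2)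
      = -(y s₀ ^ p * y s₀ / R ^ 2 * (2 * n * φ ^ p)) := by rw [hup]; ring
  have h2 : -(κ / R ^ 2 * y s₀ ^ (p + 1)) * φ = -(y s₀ ^ p * y s₀ / R ^ 2 * (κ * φ)) := by
    rw [hyp]; ring
  have h3 : 2 * n * φ ^ p < κ * φ := by
    calc 2 * n * φ ^ p ≤ 2 * n * φ := by gcongr
      _ < κ * φ := by gcongr
  rw [h2] at hderiv
  rw [h1] at hmul
  nlinarith [mul_lt_mul_of_pos_left h3 hD]

/-- Pointwise lower bound in a ball of radius comparable to `t ^ (1 / (pγ + 2))`. -/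
theorem IsSolP.exists_lower_bound {n : ℕ} {p γ C₀ : ℝ} {u₀ : Euc n → ℝ} {u : Euc n → ℝ → ℝ}
    (hp : 1 ≤ p) (hγ : 0 < γ) (hC₀ : 0 < C₀)
    (hlow : ∀ x : Euc n, C₀ * (1 + ‖x‖) ^ (-γ) ≤ u₀ x)
    (hu : IsSolP n p u₀ u ⊤) (hupos : PosOn n u ⊤) :
    ∃ c : ℝ, 0 < c ∧ ∀ R : ℝ, 1 < R → ∀ x : Euc n, ‖x‖ ≤ R / 2 →
      c * R ^ (-γ) ≤ u x (R ^ (p * γ + 2)) := by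
  have hp0 : 0 < p := by linarith
  set c := C₀ * 2 ^ (-γ) / 2 with hc_def
  have hc : 0 < c := by positivity
  set κ : ℝ := 2 * n + 1 with hκ_def
  have hκ0 : 0 < κ := by positivity
  refine ⟨(c ^ (-p) + p * κ) ^ (-(1 / p)) * (3 / 4), by positivity, fun R hR x hx => ?_⟩
  have hR0 : 0 < R := by linarith
  set A := (c * R ^ (-γ)) ^ (-p) with hA_def
  have hA : 0 < A := by positivity
  set y : ℝ → ℝ := fun s => (A + p * κ / R ^ 2 * s) ^ (-(1 / p)) with hy_def
  have hbase (s : ℝ) (hs : 0 ≤ s) : 0 < A + p * κ / R ^ 2 * s := by positivity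
  have hyd (s : ℝ) (hs : 0 ≤ s) : HasDerivAt y (-(κ / R ^ 2 * y s ^ (p + 1))) s := by
    have h1 : HasDerivAt (fun s => A + p * κ / R ^ 2 * s) (p * κ / R ^ 2) s := by
      simpa using ((hasDerivAt_id s).const_mul (p * κ / R ^ 2)).const_add A
    have h2 := h1.rpow_const (p := -(1 / p)) (Or.inl (hbase s hs).ne')
    convert h2 using 1
    rw [hy_def]
    simp only
    rw [← Real.rpow_mul (hbase s hs).le,
      show -(1 / p) * (p + 1) = -(1 / p) - 1 by field_simp; ring]
    field_simp
  have hy0 (z : Euc n) (hz : ‖z‖ ≤ R) : y 0 < u₀ z := by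
    have h1 : y 0 = c * R ^ (-γ) := by
      simp only [hy_def, hA_def, mul_zero, add_zero]
      rw [← Real.rpow_mul (by positivity), show -p * -(1 / p) = 1 by field_simp, Real.rpow_one]
    have h2 : (2 * R) ^ (-γ) ≤ (1 + ‖z‖) ^ (-γ) :=
      Real.rpow_le_rpow_of_nonpos (by positivity) (by linarith) (by linarith)
    rw [Real.mul_rpow (by norm_num) hR0.le] at h2
    have h3 : 0 < (2 : ℝ) ^ (-γ) * R ^ (-γ) := by positivity
    calc y 0 = C₀ * (2 ^ (-γ) * R ^ (-γ)) / 2 := by rw [h1, hc_def]; ring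
      _ < C₀ * (2 ^ (-γ) * R ^ (-γ)) := by linarith [mul_pos hC₀ h3]
      _ ≤ C₀ * (1 + ‖z‖) ^ (-γ) := by gcongr
      _ ≤ u₀ z := hlow z
  have hmain := hu.subsolution_lt hp hupos hR0 (κ := κ) (by linarith)
    (fun s hs => Real.rpow_pos_of_pos (hbase s hs) _) hyd hy0 (x := x) (by linarith)
    (t := R ^ (p * γ + 2)) (by positivity)
  have hyt : y (R ^ (p * γ + 2)) = (c ^ (-p) + p * κ) ^ (-(1 / p)) * R ^ (-γ) := by
    have h1 : A = c ^ (-p) * R ^ (p * γ) := by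
      rw [hA_def, Real.mul_rpow hc.le (by positivity), ← Real.rpow_mul hR0.le]
      congr 2; ring
    have h2 : R ^ (p * γ + 2) = R ^ (p * γ) * R ^ 2 := by
      rw [Real.rpow_add hR0]; norm_num
    have h3 : A + p * κ / R ^ 2 * R ^ (p * γ + 2) = (c ^ (-p) + p * κ) * R ^ (p * γ) := by
      rw [h1, h2]; field_simp
    simp only [hy_def]
    rw [h3, Real.mul_rpow (by positivity) (by positivity), ← Real.rpow_mul hR0.le]
    congr 2; field_simp
  have hφ : 3 / 4 ≤ 1 - ‖x‖ ^ 2 / R ^ 2 := by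
    have : ‖x‖ ^ 2 / R ^ 2 ≤ 1 / 4 := by
      rw [div_le_iff₀ (by positivity)]
      nlinarith [norm_nonneg x]
    linarith
  calc (c ^ (-p) + p * κ) ^ (-(1 / p)) * (3 / 4) * R ^ (-γ)
      = y (R ^ (p * γ + 2)) * (3 / 4) := by rw [hyt]; ring
    _ ≤ y (R ^ (p * γ + 2)) * (1 - ‖x‖ ^ 2 / R ^ 2) := by
        gcongr
    _ ≤ _ := hmain.le

theorem le_eLpNorm_of_le_on_ball {n : ℕ} {f : Euc n → ℝ} {a r : ℝ} (ha : 0 ≤ a) (hr : 0 < r)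
    (h : ∀ x : Euc n, ‖x‖ ≤ r → a ≤ f x) {q : ℝ≥0∞} (hq : q ≠ 0) :
    ENNReal.ofReal (a * (r ^ n * (volume (Metric.ball (0 : Euc n) 1)).toReal) ^ (1 / q.toReal)) ≤
      eLpNorm f q volume := by
  have hvol : volume (Metric.ball (0 : Euc n) r) =
      ENNReal.ofReal (r ^ n * (volume (Metric.ball (0 : Euc n) 1)).toReal) := by
    rw [Measure.addHaar_ball_of_pos _ _ hr, ENNReal.ofReal_mul (by positivity),
      ENNReal.ofReal_toReal measure_ball_lt_top.ne]
    simp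
  have hne : volume (Metric.ball (0 : Euc n) r) ≠ 0 := (Metric.measure_ball_pos _ _ hr).ne'
  have hle : eLpNorm ((Metric.ball (0 : Euc n) r).indicator fun _ => a) q volume ≤
      eLpNorm f q volume := by
    refine eLpNorm_mono fun x => ?_
    by_cases hx : x ∈ Metric.ball (0 : Euc n) r
    · have hax := h x (by simpa using (Metric.mem_ball.1 hx).le)
      rw [Set.indicator_of_mem hx, Real.norm_of_nonneg ha, Real.norm_of_nonneg (ha.trans hax)]
      exact hax
    · simp [Set.indicator_of_notMem hx]
  rw [eLpNorm_indicator_const' measurableSet_ball hne hq, hvol,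
    ENNReal.ofReal_rpow_of_nonneg (by positivity) (by positivity), Real.enorm_of_nonneg ha,
    ← ENNReal.ofReal_mul ha] at hle
  exact hle

/-- Theorem (lower bounds for algebraically decaying data): if
`u₀(x) ≥ C₀ (1+|x|)^{-γ}` then every global positive classical solution of (P) satisfies
`‖u(·,t)‖_{L^q} ≥ C t^{-(γ-n/q)/(pγ+2)}` for all `t > 1` and each `q ∈ (n/γ, ∞]`.
(For `q = ∞` the quotient `n/q`, encoded as `n / q.toReal`, is `0`.) -/
theorem stmt7 (n : ℕ) (hn : 1 ≤ n) (p γ C₀ : ℝ) (hp : 1 ≤ p) (hγ : 0 < γ) (hC₀ : 0 < C₀)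
    (u₀ : Euc n → ℝ) (hcont : Continuous u₀) (hbdd : BddAbove (Set.range u₀))
    (hpos : ∀ x, 0 < u₀ x)
    (hlow : ∀ x : Euc n, C₀ * (1 + ‖x‖) ^ (-γ) ≤ u₀ x)
    (u : Euc n → ℝ → ℝ) (hu : IsSolP n p u₀ u ⊤) (hupos : PosOn n u ⊤) :
    ∀ q : ℝ≥0∞, ENNReal.ofReal ((n : ℝ) / γ) < q → ∃ C : ℝ, 0 < C ∧
      ∀ t : ℝ, 1 < t →
        ENNReal.ofReal (C * t ^ (-((γ - (n : ℝ) / q.toReal) / (p * γ + 2)))) ≤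
          eLpNorm (fun x => u x t) q volume := by
  intro q hq
  obtain ⟨c, hc, hbound⟩ := hu.exists_lower_bound hp hγ hC₀ hlow hupos
  have hV : 0 < (volume (Metric.ball (0 : Euc n) 1)).toReal :=
    ENNReal.toReal_pos (Metric.measure_ball_pos _ _ one_pos).ne' measure_ball_lt_top.ne
  set V := (volume (Metric.ball (0 : Euc n) 1)).toReal with hV_def
  have hd : 0 < p * γ + 2 := by positivity
  refine ⟨c * ((1 / 2) ^ n * V) ^ (1 / q.toReal), by positivity, fun t ht => ?_⟩
  have ht0 : 0 < t := by linarith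
  set R := t ^ (1 / (p * γ + 2)) with hR_def
  have hR : 1 < R := Real.one_lt_rpow ht (by positivity)
  have hR0 : 0 < R := by linarith
  have hRt : R ^ (p * γ + 2) = t := by
    rw [hR_def, ← Real.rpow_mul ht0.le, one_div_mul_cancel hd.ne', Real.rpow_one]
  have h := le_eLpNorm_of_le_on_ball (f := fun x => u x t) (a := c * R ^ (-γ)) (r := R / 2)
    (q := q) (by positivity) (by positivity) (fun x hx => hRt ▸ hbound R hR x hx)
    ((zero_le).trans_lt hq).ne'
  refine le_of_eq_of_le (congrArg ENNReal.ofReal ?_) h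
  have h1 : t ^ (-((γ - n / q.toReal) / (p * γ + 2))) = R ^ (-γ) * (R ^ n) ^ (1 / q.toReal) := by
    rw [← Real.rpow_natCast R n, ← Real.rpow_mul hR0.le, ← Real.rpow_add hR0, hR_def,
      ← Real.rpow_mul ht0.le]
    congr 1; ring
  have h2 : (R / 2) ^ n * V = (1 / 2) ^ n * V * R ^ n := by
    rw [div_eq_mul_one_div, mul_pow]; ring
  rw [← hV_def, h1, h2, Real.mul_rpow (x := (1 / 2) ^ n * V) (y := R ^ n) (by positivity)
    (by positivity)]
  ring
end
end
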